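/- arXiv:1503.02430 — 4 statements merged into one kernel-verified Lean document; each statement's English description precedes it below -/
import Mathlib

section
/- Let K be a compact Hausdorff space such that E = C(K;ℝ) is order complete (Dedekind complete), and let T be a Markov operator on E. Then the fixed space F = ker(I − T) is an order complete lattice subspace of E (every nonempty subset of F that is bounded above by an element of F has a supremum within F; F need not be a sublattice of E), and F endowed with the supremum norm ‖·‖_∞ is a Banach lattice and an AM-space with unit 𝟙, i.e. ‖f ∨_F g‖_∞ = max(‖f‖_∞, ‖g‖_∞) for all 0 ≤ f, g ∈ F (where ∨_F denotes the supremum formed within F) and 𝟙 is the greatest element of the unit ball of F. -/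
open scoped ComplexOrder ENNReal
open Filter Topology

noncomputable section

/-- The sup norm is at most `c` iff `f` lies between the constants `-c` and `c`. -/
theorem ContinuousMap.norm_le_iff_neg_smul_one_le_and_le {K : Type*} [TopologicalSpace K]
    [CompactSpace K] (f : C(K, ℝ)) {c : ℝ} (hc : 0 ≤ c) :
    ‖f‖ ≤ c ↔ -(c • (1 : C(K, ℝ))) ≤ f ∧ f ≤ c • (1 : C(K, ℝ)) := by
  simp only [ContinuousMap.norm_le f hc, ContinuousMap.le_def, Real.norm_eq_abs, abs_le,
    forall_and, ContinuousMap.neg_apply, ContinuousMap.smul_apply, ContinuousMap.one_apply,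
    smul_eq_mul, mul_one]

/-- The sup norm is monotone on nonnegative functions. -/
theorem ContinuousMap.norm_le_norm_of_nonneg_of_le {K : Type*} [TopologicalSpace K]
    [CompactSpace K] {f g : C(K, ℝ)} (hf : 0 ≤ f) (hfg : f ≤ g) : ‖f‖ ≤ ‖g‖ := by
  obtain ⟨-, hg⟩ := (norm_le_iff_neg_smul_one_le_and_le g (norm_nonneg g)).1 le_rfl
  refine (norm_le_iff_neg_smul_one_le_and_le f (norm_nonneg g)).2 ⟨?_, hfg.trans hg⟩
  exact (neg_nonpos.2 (hf.trans (hfg.trans hg))).trans hf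

/-- In a conditionally complete order, a monotone map has a least fixed point above any nonempty
set of fixed points that is bounded above by a fixed point. -/
theorem Monotone.exists_least_fixedPoint_ge {E : Type*} [PartialOrder E]
    (hE : ∀ S : Set E, S.Nonempty → BddAbove S → ∃ s, IsLUB S s) {T : E → E} (hT : Monotone T)
    {S : Set E} (hS : ∀ f ∈ S, T f = f) (hne : S.Nonempty)
    (hb : ∃ b, T b = b ∧ ∀ f ∈ S, f ≤ b) :
    ∃ s, T s = s ∧ (∀ f ∈ S, f ≤ s) ∧ ∀ b, T b = b → (∀ f ∈ S, f ≤ b) → s ≤ b := by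
  obtain ⟨b, hTb, hSb⟩ := hb
  let A : Set E := {g | T g ≤ g ∧ ∀ f ∈ S, f ≤ g}
  have hbA : b ∈ A := ⟨hTb.le, hSb⟩
  have hSA : S ⊆ lowerBounds A := fun f hf g hg => hg.2 f hf
  obtain ⟨s, hs⟩ := hE (lowerBounds A) (hne.mono hSA) ⟨b, fun _ hx => hx hbA⟩
  have hs : IsGLB A s := isLUB_lowerBounds.1 hs
  have hSs : ∀ f ∈ S, f ≤ s := fun f hf => hs.2 (hSA hf)
  have hTs : T s ≤ s := hs.2 fun g hg => (hT (hs.1 hg)).trans hg.1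
  have hTsA : T s ∈ A := ⟨hT hTs, fun f hf => (hS f hf).ge.trans (hT (hSs f hf))⟩
  exact ⟨s, hTs.antisymm (hs.1 hTsA), hSs, fun c hc hSc => hs.1 ⟨hc.le, hSc⟩⟩

/-- **Theorem 2.1.** Let `K` be compact Hausdorff with `C(K;ℝ)` order complete and let `T`
be a Markov operator on `C(K;ℝ)` (positive with `T 𝟙 = 𝟙`). Then the fixed space
`F = ker(1 - T) = {f : T f = f}` is an order complete lattice subspace of `C(K;ℝ)`
(every nonempty subset of `F` bounded above in `F` has a supremum within `F`), and,
endowed with the supremum norm, `F` is a Banach lattice and an AM-space with unit `𝟙`: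
the modulus formed within `F` preserves the norm, `‖f ∨_F g‖ = max (‖f‖, ‖g‖)` for
`0 ≤ f, g ∈ F`, and the unit ball of `F` is the order interval `[-𝟙, 𝟙]`. -/
theorem fixed_space_of_markov_operator
    {K : Type*} [TopologicalSpace K] [CompactSpace K] [T2Space K]
    (hDC : ∀ S : Set C(K, ℝ), S.Nonempty → BddAbove S → ∃ s, IsLUB S s)
    (T : C(K, ℝ) →L[ℝ] C(K, ℝ))
    (hpos : ∀ f : C(K, ℝ), 0 ≤ f → 0 ≤ T f)
    (hone : T 1 = 1) :
    -- (1) the fixed space is an order complete lattice subspace: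
    (∀ S : Set C(K, ℝ), (∀ f ∈ S, T f = f) → S.Nonempty →
        (∃ b, T b = b ∧ ∀ f ∈ S, f ≤ b) →
        ∃ s, T s = s ∧ (∀ f ∈ S, f ≤ s) ∧ ∀ b, T b = b → (∀ f ∈ S, f ≤ b) → s ≤ b) ∧
    -- (2) the fixed space is a Banach lattice w.r.t. `‖·‖_∞`: the modulus `|f|_F` formed
    --     within the fixed space satisfies `‖|f|_F‖_∞ = ‖f‖_∞`:
    (∀ f m : C(K, ℝ), T f = f → T m = m → f ≤ m → -f ≤ m →
        (∀ b, T b = b → f ≤ b → -f ≤ b → m ≤ b) → ‖m‖ = ‖f‖) ∧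
    -- (3) the fixed space is an AM-space: `‖f ∨_F g‖_∞ = max (‖f‖_∞, ‖g‖_∞)` for positive
    --     `f, g` in the fixed space, `∨_F` being the supremum formed within the fixed space:
    (∀ f g s : C(K, ℝ), T f = f → T g = g → 0 ≤ f → 0 ≤ g → T s = s → f ≤ s → g ≤ s →
        (∀ b, T b = b → f ≤ b → g ≤ b → s ≤ b) → ‖s‖ = max ‖f‖ ‖g‖) ∧
    -- (4) `𝟙` is a unit: the unit ball of the fixed space is the order interval `[-𝟙, 𝟙]`:
    (∀ f : C(K, ℝ), T f = f → (‖f‖ ≤ 1 ↔ -1 ≤ f ∧ f ≤ 1)) := by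
  have hmono : Monotone T := fun f g hfg => by
    simpa using hpos (g - f) (sub_nonneg.2 hfg)
  have hconst : ∀ c : ℝ, T (c • (1 : C(K, ℝ))) = c • (1 : C(K, ℝ)) := fun c => by
    rw [map_smul, hone]
  refine ⟨fun S hS hne hb => hmono.exists_least_fixedPoint_ge hDC hS hne hb, ?_, ?_, ?_⟩
  · intro f m _ _ hfm hnfm hmin
    obtain ⟨hf₁, hf₂⟩ :=
      (ContinuousMap.norm_le_iff_neg_smul_one_le_and_le f (norm_nonneg f)).1 le_rfl
    have hm : m ≤ ‖f‖ • (1 : C(K, ℝ)) := hmin _ (hconst _) hf₂ (neg_le.1 hf₁)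
    have hm₀ : 0 ≤ m := (abs_nonneg f).trans (abs_le'.2 ⟨hfm, hnfm⟩)
    apply le_antisymm
    · exact (ContinuousMap.norm_le_iff_neg_smul_one_le_and_le m (norm_nonneg f)).2
        ⟨(neg_nonpos.2 (hm₀.trans hm)).trans hm₀, hm⟩
    · obtain ⟨-, hm₂⟩ :=
        (ContinuousMap.norm_le_iff_neg_smul_one_le_and_le m (norm_nonneg m)).1 le_rfl
      exact (ContinuousMap.norm_le_iff_neg_smul_one_le_and_le f (norm_nonneg m)).2
        ⟨neg_le.1 (hnfm.trans hm₂), hfm.trans hm₂⟩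
  · intro f g s _ _ hf hg _ hfs hgs hmin
    have hc : 0 ≤ max ‖f‖ ‖g‖ := (norm_nonneg f).trans (le_max_left _ _)
    have hs : s ≤ max ‖f‖ ‖g‖ • (1 : C(K, ℝ)) := hmin _ (hconst _)
      ((ContinuousMap.norm_le_iff_neg_smul_one_le_and_le f hc).1 (le_max_left _ _)).2
      ((ContinuousMap.norm_le_iff_neg_smul_one_le_and_le g hc).1 (le_max_right _ _)).2
    have hs₀ : 0 ≤ s := hf.trans hfs
    apply le_antisymm
    · exact (ContinuousMap.norm_le_iff_neg_smul_one_le_and_le s hc).2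
        ⟨(neg_nonpos.2 (hs₀.trans hs)).trans hs₀, hs⟩
    · exact max_le (ContinuousMap.norm_le_norm_of_nonneg_of_le hf hfs)
        (ContinuousMap.norm_le_norm_of_nonneg_of_le hg hgs)
  · intro f _
    simpa only [one_smul] using
      ContinuousMap.norm_le_iff_neg_smul_one_le_and_le f zero_le_one

end
end

section
/- Let (f_j)_{j∈J} be a net of analytic functions on the closed unit disk 𝔻̄ such that each f_j satisfies f_j(1) = 1 (WS1) and f_j^{(k)}(0) ≥ 0 for every k ∈ ℕ₀ (WS2), and let f_j(z) = Σ_{k=0}^∞ a_{j,k} z^k be the power series expansion of f_j around 0. Then the following are equivalent: (i) f_j(z) → 0 (over the net in j) for every z ∈ ℂ with |z| < 1, i.e. (f_j) is a weighting scheme; (ii) for each fixed k ∈ ℕ₀, a_{j,k} → 0 over the net in j. -/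
open scoped ComplexOrder ENNReal
open Filter Topology

noncomputable section

/-- `a : ℕ → ℂ` is the coefficient sequence of a function analytic on (a neighbourhood of)
the closed unit disk `𝔻̄`: its power series around `0` has radius of convergence `> 1`. -/
def HasDiskRadius (a : ℕ → ℂ) : Prop :=
  ∃ ρ : ℝ, 1 < ρ ∧ ∀ z : ℂ, ‖z‖ < ρ → Summable fun k => a k * z ^ k

/-- A net `(f_j)_{j ∈ J}` (along a filter `F` on the index type `J`) of functions analytic on
the closed unit disk, given by their power series coefficients `a j : ℕ → ℂ` around `0`, is a
weighting scheme if (WS1) `f_j(1) = Σ_k a_{j,k} = 1` for each `j`, (WS2) `f_j^{(k)}(0) ≥ 0`,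
i.e. `a_{j,k} ≥ 0`, for all `j, k`, and (WS3) `f_j(z) → 0` along the net for every `|z| < 1`. -/
def IsWeightingScheme {J : Type*} (F : Filter J) (a : J → ℕ → ℂ) : Prop :=
  (∀ j, HasDiskRadius (a j)) ∧
  (∀ j, (∑' k, a j k) = 1) ∧
  (∀ j k, 0 ≤ a j k) ∧
  (∀ z : ℂ, ‖z‖ < 1 → Tendsto (fun j => ∑' k, a j k * z ^ k) F (nhds 0))

/-- For `f` analytic on the closed unit disk with power series `Σ_k a_k z^k` around `0` and an
operator `T` with `r(T) = 1`, the operator `f(T) := Σ_k a_k T^k`. -/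
def wsApply {E : Type*} [NormedAddCommGroup E] [NormedSpace ℂ E]
    (a : ℕ → ℂ) (T : E →L[ℂ] E) : E →L[ℂ] E :=
  ∑' k, a k • T ^ k

/-- An operator `T` (with `r(T) = 1`) is (WS)-bounded if there is a weighting scheme
`(f_j)_{j ∈ J}` such that `{f_j(T) : j ∈ J}` is bounded in operator norm. -/
def WSBounded {E : Type*} [NormedAddCommGroup E] [NormedSpace ℂ E] (T : E →L[ℂ] E) : Prop :=
  ∃ (J : Type) (F : Filter J), F.NeBot ∧
    ∃ a : J → ℕ → ℂ, IsWeightingScheme F a ∧ ∃ C : ℝ, ∀ j : J, ‖wsApply (a j) T‖ ≤ C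

theorem norm_le_norm_tsum_of_nonneg {b : ℕ → ℂ} (hb : ∀ k, 0 ≤ b k) (hs : Summable b) (k : ℕ) :
    ‖b k‖ ≤ ‖∑' i, b i‖ := by
  have hle : b k ≤ ∑' i, b i := hs.le_tsum k fun i _ => hb i
  exact CStarAlgebra.norm_le_norm_of_nonneg_of_le (hb k) hle

theorem HasDiskRadius.summable_mul_pow {a : ℕ → ℂ} (ha : HasDiskRadius a) {z : ℂ} (hz : ‖z‖ ≤ 1) :
    Summable fun k => a k * z ^ k := by
  obtain ⟨ρ, hρ, h⟩ := ha
  exact h z (hz.trans_lt hρ)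

/-- **Proposition 4.4.** Let `(f_j)_{j∈J}` be a net of analytic functions on the closed unit
disk (given by their power series coefficients `a j` around `0`, of radius `> 1`), each
satisfying (WS1) `Σ_k a_{j,k} = 1` and (WS2) `a_{j,k} ≥ 0`. Then the following are
equivalent: (i) `f_j(z) → 0` along the net for every `|z| < 1`, i.e. `(f_j)` is a weighting
scheme; (ii) for each fixed `k`, `a_{j,k} → 0` along the net. -/
theorem weighting_scheme_iff_coefficients_tendsto_zero
    {J : Type*} (F : Filter J) [F.NeBot] (a : J → ℕ → ℂ)
    (hrad : ∀ j, HasDiskRadius (a j))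
    (hWS1 : ∀ j, (∑' k, a j k) = 1)
    (hWS2 : ∀ j k, 0 ≤ a j k) :
    (∀ z : ℂ, ‖z‖ < 1 → Tendsto (fun j => ∑' k, a j k * z ^ k) F (nhds 0)) ↔
      ∀ k : ℕ, Tendsto (fun j => a j k) F (nhds 0) := by
  constructor
  · intro h k
    have hz : ‖(1 / 2 : ℂ)‖ < 1 := by norm_num
    have hpos : (0 : ℂ) ≤ 1 / 2 := by
      rw [Complex.le_def]
      norm_num
    have hbound (j : J) : ‖a j k * (1 / 2) ^ k‖ ≤ ‖∑' i, a j i * (1 / 2 : ℂ) ^ i‖ :=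
      norm_le_norm_tsum_of_nonneg (fun i => mul_nonneg (hWS2 j i) (pow_nonneg hpos i))
        ((hrad j).summable_mul_pow hz.le) k
    have hlim : Tendsto (fun j => a j k * (1 / 2 : ℂ) ^ k) F (𝓝 0) :=
      squeeze_zero_norm hbound (by simpa using (h _ hz).norm)
    simpa [mul_assoc, ← mul_pow] using hlim.mul_const ((2 : ℂ) ^ k)
  · intro h z hz
    have hone (j : J) (k : ℕ) : ‖a j k‖ ≤ 1 := by
      have hs : Summable (a j) := by
        simpa using (hrad j).summable_mul_pow (z := 1) (by simp)
      simpa [hWS1 j] using norm_le_norm_tsum_of_nonneg (hWS2 j) hs k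
    have hlim := tendsto_tsum_of_dominated_convergence (𝓕 := F)
      (f := fun j k => a j k * z ^ k) (g := fun _ => (0 : ℂ)) (bound := fun k => ‖z‖ ^ k)
      (summable_geometric_of_lt_one (norm_nonneg z) hz)
      (fun k => by simpa using (h k).mul_const (z ^ k))
      (Eventually.of_forall fun j k => by
        rw [norm_mul, norm_pow]
        exact mul_le_of_le_one_left (by positivity) (hone j k))
    simpa using hlim

end
end

section
/- Let X be a complex Banach space and T a bounded linear operator on X. Suppose that r(T) = 1 is a spectral value of T and an m-th order pole of the resolvent of T, where m ∈ ℕ. Then T is (WS)-bounded if and only if m = 1. -/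
open scoped ComplexOrder ENNReal
open Filter Topology

noncomputable section

/-- `μ₀` is an `m`-th order pole of the resolvent of `T`: `μ₀` is an isolated point of the
spectrum of `T` and the resolvent map `μ ↦ R(μ,T)` has a pole of order `m` at `μ₀`, i.e.
`μ ↦ (μ - μ₀)^m R(μ,T)` extends analytically near `μ₀` with nonzero value at `μ₀`. -/
def HasResolventPoleOfOrder {X : Type*} [NormedAddCommGroup X] [NormedSpace ℂ X]
    [CompleteSpace X] (T : X →L[ℂ] X) (μ₀ : ℂ) (m : ℕ) : Prop :=
  μ₀ ∈ spectrum ℂ T ∧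
  (∃ ε : ℝ, 0 < ε ∧ ∀ μ : ℂ, μ ≠ μ₀ → ‖μ - μ₀‖ < ε → μ ∉ spectrum ℂ T) ∧
  ∃ g : ℂ → (X →L[ℂ] X), AnalyticAt ℂ g μ₀ ∧ g μ₀ ≠ 0 ∧
    ∀ᶠ μ in nhdsWithin μ₀ {μ₀}ᶜ, (μ - μ₀) ^ m • resolvent T μ = g μ

/-- By Gelfand's formula the powers of an operator of spectral radius `1` grow slower than any
geometric sequence of ratio `> 1`. -/
theorem eventually_norm_pow_le_of_spectralRadius_eq_one
    {X : Type*} [NormedAddCommGroup X] [NormedSpace ℂ X] [CompleteSpace X]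
    {T : X →L[ℂ] X} (hr : spectralRadius ℂ T = 1) {s : ℝ} (hs : 1 < s) :
    ∀ᶠ k : ℕ in atTop, ‖T ^ k‖ ≤ s ^ k := by
  have h := spectrum.pow_norm_pow_one_div_tendsto_nhds_spectralRadius T
  rw [hr] at h
  have h1 : (1 : ℝ≥0∞) < ENNReal.ofReal s := by simpa using hs
  filter_upwards [h.eventually_lt_const h1, eventually_gt_atTop 0] with k hk hk0
  have h2 := ((ENNReal.ofReal_lt_ofReal_iff (by linarith)).1 hk).le
  have h3 := pow_le_pow_left₀ (by positivity) h2 k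
  rwa [one_div, Real.rpow_inv_natCast_pow (norm_nonneg _) hk0.ne'] at h3

theorem HasDiskRadius.summable_smul {E : Type*} [NormedAddCommGroup E] [NormedSpace ℂ E]
    [CompleteSpace E] {a : ℕ → ℂ} (ha : HasDiskRadius a) {b : ℕ → E}
    (hb : ∀ s : ℝ, 1 < s → ∀ᶠ k : ℕ in atTop, ‖b k‖ ≤ s ^ k) :
    Summable fun k => a k • b k := by
  obtain ⟨ρ, hρ, h⟩ := ha
  obtain ⟨s, hs, hsρ⟩ := exists_between hρ
  have hs0 : 0 ≤ s := by linarith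
  have h1 := (h (s : ℂ) (by simpa [abs_of_nonneg hs0] using hsρ)).norm
  refine Summable.of_norm_bounded_eventually_nat h1 ?_
  filter_upwards [hb s hs] with k hk
  rw [norm_smul, norm_mul, norm_pow, Complex.norm_real, Real.norm_of_nonneg hs0]
  gcongr

theorem HasDiskRadius.summable {a : ℕ → ℂ} (ha : HasDiskRadius a) : Summable a := by
  obtain ⟨ρ, hρ, h⟩ := ha
  simpa using h 1 (by simpa using hρ)

theorem HasDiskRadius.summable_mul_natCast {a : ℕ → ℂ} (ha : HasDiskRadius a) :
    Summable fun k => a k * (k : ℂ) := by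
  refine ha.summable_smul (b := fun k : ℕ => (k : ℂ)) fun s hs => ?_
  filter_upwards [(tendsto_pow_const_div_const_pow_of_one_lt 1 hs).eventually_le_const one_pos]
    with k hk
  rw [div_le_one (by positivity)] at hk
  simpa using hk

theorem HasDiskRadius.summable_smul_pow
    {X : Type*} [NormedAddCommGroup X] [NormedSpace ℂ X] [CompleteSpace X]
    {T : X →L[ℂ] X} (hr : spectralRadius ℂ T = 1) {a : ℕ → ℂ} (ha : HasDiskRadius a) :
    Summable fun k => a k • T ^ k :=
  ha.summable_smul fun _ hs => eventually_norm_pow_le_of_spectralRadius_eq_one hr hs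

/-- The coefficients of `z ↦ (s - 1) / (s - z)` around `0`. -/
def abelWeight (s : ℝ) (k : ℕ) : ℂ := ((s - 1) / s * s⁻¹ ^ k : ℝ)

theorem hasSum_abelWeight_mul_pow {s : ℝ} (hs : 1 < s) {z : ℂ} (hz : ‖z‖ < s) :
    HasSum (fun k => abelWeight s k * z ^ k) ((s - 1) / (s - z)) := by
  have hs0 : (s : ℂ) ≠ 0 := by exact_mod_cast (by linarith : s ≠ 0)
  have hsz : (s : ℂ) - z ≠ 0 := by
    intro h
    rw [← sub_eq_zero.1 h, Complex.norm_real, Real.norm_of_nonneg (by linarith)] at hz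
    exact lt_irrefl _ hz
  have h1 : ‖(s : ℂ)⁻¹ * z‖ < 1 := by
    rw [norm_mul, norm_inv, Complex.norm_real, Real.norm_of_nonneg (by linarith),
      inv_mul_lt_one₀ (by linarith)]
    exact hz
  have h2 := (hasSum_geometric_of_norm_lt_one h1).mul_left (((s : ℂ) - 1) / s)
  have h3 : 1 - (s : ℂ)⁻¹ * z = (s - z) / s := by field_simp
  have h4 : ((s : ℂ) - 1) / s * (1 - (s : ℂ)⁻¹ * z)⁻¹ = (s - 1) / (s - z) := by
    rw [h3]
    field_simp
  rw [h4] at h2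
  refine h2.congr_fun fun k => ?_
  simp only [abelWeight]
  push_cast
  ring

theorem hasDiskRadius_abelWeight {s : ℝ} (hs : 1 < s) : HasDiskRadius (abelWeight s) :=
  ⟨s, hs, fun _ hz => (hasSum_abelWeight_mul_pow hs hz).summable⟩

theorem isWeightingScheme_abelWeight {J : Type*} {F : Filter J} {s : J → ℝ}
    (hs : ∀ j, 1 < s j) (hlim : Tendsto s F (𝓝 1)) :
    IsWeightingScheme F fun j => abelWeight (s j) := by
  refine ⟨fun j => hasDiskRadius_abelWeight (hs j), fun j => ?_, fun j k => ?_, fun z hz => ?_⟩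
  · have h := (hasSum_abelWeight_mul_pow (hs j) (z := 1) (by simpa using hs j)).tsum_eq
    have h0 : (s j : ℂ) - 1 ≠ 0 := sub_ne_zero.2 (by exact_mod_cast (hs j).ne')
    simpa [div_self h0] using h
  · have := hs j
    have h : 0 ≤ (s j - 1) / s j * (s j)⁻¹ ^ k :=
      mul_nonneg (div_nonneg (by linarith) (by linarith)) (pow_nonneg (inv_nonneg.2 (by linarith)) k)
    exact Complex.zero_le_real.2 h
  · have h0 : (1 : ℂ) - z ≠ 0 := by
      intro h
      simp [← sub_eq_zero.1 h] at hz
    have hc : Tendsto (fun j => (s j : ℂ)) F (𝓝 1) := by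
      simpa [Function.comp_def] using (Complex.continuous_ofReal.tendsto 1).comp hlim
    have h1 := (hc.sub_const 1).div (hc.sub_const z) h0
    rw [sub_self, zero_div] at h1
    refine h1.congr fun j => ?_
    exact (hasSum_abelWeight_mul_pow (hs j) (hz.trans (hs j))).tsum_eq.symm

theorem wsApply_abelWeight
    {X : Type*} [NormedAddCommGroup X] [NormedSpace ℂ X] [CompleteSpace X]
    {T : X →L[ℂ] X} (hr : spectralRadius ℂ T = 1) {s : ℝ} (hs : 1 < s) :
    wsApply (abelWeight s) T = ((s : ℂ) - 1) • resolvent T (s : ℂ) := by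
  have hs0 : (s : ℂ) ≠ 0 := by exact_mod_cast (by linarith : s ≠ 0)
  have hsum := (hasDiskRadius_abelWeight hs).summable_smul_pow hr
  have hu : IsUnit (algebraMap ℂ (X →L[ℂ] X) s - T) := by
    refine spectrum.mem_resolventSet_of_spectralRadius_lt ?_
    rw [hr, ← ENNReal.coe_one, ENNReal.coe_lt_coe, ← NNReal.coe_lt_coe]
    simpa [abs_of_pos (one_pos.trans hs)] using hs
  have hstep : ∀ k, (algebraMap ℂ (X →L[ℂ] X) s - T) * (abelWeight s k • T ^ k) =
      (s : ℂ) • (abelWeight s k • T ^ k) - (s : ℂ) • (abelWeight s (k + 1) • T ^ (k + 1)) := by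
    intro k
    have h : (s : ℂ) * abelWeight s (k + 1) = abelWeight s k := by
      simp only [abelWeight]
      push_cast
      rw [pow_succ]
      field_simp
    rw [sub_mul, Algebra.algebraMap_eq_smul_one, smul_one_mul, smul_smul (s : ℂ) (abelWeight s (k + 1)), h,
      mul_smul_comm, ← pow_succ']
  have hmul : (algebraMap ℂ (X →L[ℂ] X) s - T) * wsApply (abelWeight s) T =
      ((s : ℂ) - 1) • (1 : X →L[ℂ] X) := by
    have hsum' := (summable_nat_add_iff 1).2 hsum
    rw [wsApply, ← hsum.tsum_mul_left, tsum_congr hstep,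
      (hsum.const_smul (s : ℂ)).tsum_sub (hsum'.const_smul (s : ℂ)), hsum.tsum_const_smul,
      hsum'.tsum_const_smul, ← smul_sub, hsum.tsum_eq_zero_add, add_sub_cancel_right, smul_smul]
    simp only [abelWeight, pow_zero]
    push_cast
    congr 1
    field_simp
  rw [resolvent]
  calc wsApply (abelWeight s) T
      = Ring.inverse (algebraMap ℂ (X →L[ℂ] X) s - T) *
          ((algebraMap ℂ (X →L[ℂ] X) s - T) * wsApply (abelWeight s) T) := by
        rw [← mul_assoc, Ring.inverse_mul_cancel _ hu, one_mul]
    _ = _ := by rw [hmul, mul_smul_comm, mul_one]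

theorem wsBounded_of_first_order_pole
    {X : Type*} [NormedAddCommGroup X] [NormedSpace ℂ X] [CompleteSpace X]
    {T : X →L[ℂ] X} (hr : spectralRadius ℂ T = 1) (hpole : HasResolventPoleOfOrder T 1 1) :
    WSBounded T := by
  obtain ⟨-, -, g, hg, -, heq⟩ := hpole
  have hbdd : ∀ᶠ μ in 𝓝[≠] (1 : ℂ), ‖(μ - 1) • resolvent T μ‖ ≤ ‖g 1‖ + 1 := by
    have h1 : ∀ᶠ μ in 𝓝[≠] (1 : ℂ), ‖g μ‖ ≤ ‖g 1‖ + 1 :=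
      nhdsWithin_le_nhds (hg.continuousAt.norm.eventually_le_const (lt_add_one _))
    filter_upwards [h1, heq] with μ h1 h2
    rw [pow_one] at h2
    rwa [h2]
  obtain ⟨δ, hδ, hball⟩ := Metric.eventually_nhds_iff.1 (eventually_nhdsWithin_iff.1 hbdd)
  set s : ℕ → ℝ := fun n => 1 + δ / 2 * (1 / ((n : ℝ) + 1)) with hs_def
  have hpos : ∀ n : ℕ, 0 < 1 / ((n : ℝ) + 1) := fun n => by positivity
  have hle : ∀ n : ℕ, 1 / ((n : ℝ) + 1) ≤ 1 := fun n => by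
    rw [div_le_one (by positivity)]
    linarith [(Nat.cast_nonneg n : (0 : ℝ) ≤ n)]
  have hs : ∀ n, 1 < s n := fun n => by
    have := mul_pos (half_pos hδ) (hpos n)
    simp only [hs_def]
    linarith
  have hsδ : ∀ n, s n - 1 < δ := fun n => by
    have := mul_le_mul_of_nonneg_left (hle n) (half_pos hδ).le
    simp only [hs_def]
    linarith
  have hlim : Tendsto s atTop (𝓝 1) := by
    simpa [hs_def] using (tendsto_one_div_add_atTop_nhds_zero_nat.const_mul (δ / 2)).const_add (1 : ℝ)
  refine ⟨ℕ, atTop, inferInstance, fun n => abelWeight (s n),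
    isWeightingScheme_abelWeight hs hlim, ‖g 1‖ + 1, fun n => ?_⟩
  rw [wsApply_abelWeight hr (hs n)]
  refine hball ?_ ?_
  · rw [dist_eq_norm, ← Complex.ofReal_one, ← Complex.ofReal_sub, Complex.norm_real,
      Real.norm_of_nonneg (by linarith [hs n])]
    exact hsδ n
  · simpa using (hs n).ne'

/-- A pole of order at least two produces a Jordan chain of length two. -/
theorem HasResolventPoleOfOrder.exists_jordan_chain
    {X : Type*} [NormedAddCommGroup X] [NormedSpace ℂ X] [CompleteSpace X]
    {T : X →L[ℂ] X} {μ₀ : ℂ} {m : ℕ} (hm : 2 ≤ m) (hpole : HasResolventPoleOfOrder T μ₀ m) :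
    ∃ A B : X →L[ℂ] X, A ≠ 0 ∧ T * A = μ₀ • A ∧ T * B = μ₀ • B + A := by
  obtain ⟨-, ⟨ε, hε, hiso⟩, g, hg, hg0, heq⟩ := hpole
  have hgd := hg.differentiableAt.hasDerivAt
  set h : ℂ → (X →L[ℂ] X) := fun μ =>
    (algebraMap ℂ (X →L[ℂ] X) μ - T) * g μ - (μ - μ₀) ^ m • (1 : X →L[ℂ] X) with h_def
  have hd : HasDerivAt h (g μ₀ + (algebraMap ℂ (X →L[ℂ] X) μ₀ - T) * deriv g μ₀) μ₀ := by
    have h1 : HasDerivAt (fun μ : ℂ => algebraMap ℂ (X →L[ℂ] X) μ - T) 1 μ₀ := by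
      simpa [Algebra.algebraMap_eq_smul_one] using
        ((hasDerivAt_id μ₀).smul_const (1 : X →L[ℂ] X)).sub_const T
    have h2 := (((hasDerivAt_id μ₀).sub_const μ₀).pow m).smul_const (1 : X →L[ℂ] X)
    have h3 := (h1.mul hgd).sub h2
    have h4 : m - 1 ≠ 0 := by omega
    convert! h3 using 1
    simp [h4]
  have hzero : ∀ᶠ μ in 𝓝[≠] μ₀, h μ = 0 := by
    have hball : ∀ᶠ μ in 𝓝[≠] μ₀, ‖μ - μ₀‖ < ε := by
      refine nhdsWithin_le_nhds ?_
      simpa [Metric.ball, dist_eq_norm] using Metric.ball_mem_nhds μ₀ hε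
    filter_upwards [hball, heq, self_mem_nhdsWithin] with μ h1 h2 h3
    have hu : IsUnit (algebraMap ℂ (X →L[ℂ] X) μ - T) := by
      simpa [spectrum.mem_iff] using hiso μ h3 h1
    rw [h_def]
    simp only
    rw [← h2, mul_smul_comm, resolvent, Ring.mul_inverse_cancel _ hu, sub_self]
  have h0 : h μ₀ = 0 :=
    tendsto_nhds_unique (hd.continuousAt.tendsto.mono_left nhdsWithin_le_nhds)
      (tendsto_const_nhds.congr' (hzero.mono fun _ hμ => hμ.symm))
  have hev : h =ᶠ[𝓝 μ₀] fun _ => 0 := by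
    filter_upwards [eventually_nhdsWithin_iff.1 hzero] with μ hμ
    by_cases hμ0 : μ = μ₀
    · rw [hμ0, h0]
    · exact hμ hμ0
  have hd0 := hd.unique ((hasDerivAt_const μ₀ (0 : X →L[ℂ] X)).congr_of_eventuallyEq hev)
  have hm0 : m ≠ 0 := by omega
  refine ⟨g μ₀, deriv g μ₀, hg0, ?_, ?_⟩
  · simp only [h_def, sub_self, zero_pow hm0, zero_smul, sub_zero, sub_mul,
      Algebra.algebraMap_eq_smul_one, smul_one_mul] at h0
    exact (sub_eq_zero.1 h0).symm
  · simp only [sub_mul, Algebra.algebraMap_eq_smul_one, smul_one_mul] at hd0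
    rw [← sub_eq_zero, ← neg_eq_zero, ← hd0]
    abel

theorem pow_mul_eq_of_jordan_chain {R : Type*} [Ring R] {T A B : R}
    (hA : T * A = A) (hB : T * B = B + A) (k : ℕ) : T ^ k * B = B + k • A := by
  induction k with
  | zero => simp
  | succ k ih =>
    rw [pow_succ', mul_assoc, ih, mul_add, hB, mul_smul_comm, hA, succ_nsmul]
    abel

theorem wsApply_mul_of_jordan_chain
    {X : Type*} [NormedAddCommGroup X] [NormedSpace ℂ X] [CompleteSpace X]
    {T A B : X →L[ℂ] X} (hr : spectralRadius ℂ T = 1) (hA : T * A = A) (hB : T * B = B + A)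
    {a : ℕ → ℂ} (ha : HasDiskRadius a) :
    wsApply a T * B = (∑' k, a k) • B + (∑' k, a k * (k : ℂ)) • A := by
  have h1 := ha.summable.hasSum.smul_const B
  have h2 := ha.summable_mul_natCast.hasSum.smul_const A
  rw [wsApply, ← (ha.summable_smul_pow hr).tsum_mul_right, ← (h1.add h2).tsum_eq]
  refine tsum_congr fun k => ?_
  rw [smul_mul_assoc, pow_mul_eq_of_jordan_chain hA hB, smul_add, mul_smul, Nat.cast_smul_eq_nsmul]

/-- Bernoulli's inequality, averaged over a probability weight on `ℕ`. -/
theorem one_sub_mul_le_norm_tsum_mul_pow {a : ℕ → ℂ} (ha : HasDiskRadius a)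
    (hsum : ∑' k, a k = 1) (hnonneg : ∀ k, 0 ≤ a k) {r : ℝ} (hr0 : 0 ≤ r) (hr1 : r ≤ 1) :
    1 - (1 - r) * ‖∑' k, a k * (k : ℂ)‖ ≤ ‖∑' k, a k * (r : ℂ) ^ k‖ := by
  obtain ⟨c, rfl⟩ : ∃ c : ℕ → ℝ, a = fun k => (c k : ℂ) :=
    ⟨fun k => (a k).re, funext fun k => Complex.eq_re_of_ofReal_le (r := 0) (by simpa using hnonneg k)⟩
  have hc : ∀ k, 0 ≤ c k := fun k => Complex.zero_le_real.1 (hnonneg k)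
  have s0 : Summable c := Complex.summable_ofReal.1 ha.summable
  have s1 : Summable fun k => c k * (k : ℝ) :=
    Complex.summable_ofReal.1 (by simpa using ha.summable_mul_natCast)
  have s2 : Summable fun k => c k * r ^ k :=
    s0.of_nonneg_of_le (fun k => mul_nonneg (hc k) (pow_nonneg hr0 k))
      fun k => mul_le_of_le_one_right (hc k) (pow_le_one₀ hr0 hr1)
  have e0 : ∑' k, c k = 1 := by 
    rw [← Complex.ofReal_tsum] at hsum
    exact_mod_cast hsum
  have e1 : ‖∑' k, (c k : ℂ) * (k : ℂ)‖ = ∑' k, c k * (k : ℝ) := by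
    rw [← Real.norm_of_nonneg (tsum_nonneg fun k => mul_nonneg (hc k) k.cast_nonneg),
      ← Complex.norm_real]
    push_cast
    rfl
  have e2 : ‖∑' k, (c k : ℂ) * (r : ℂ) ^ k‖ = ∑' k, c k * r ^ k := by
    rw [← Real.norm_of_nonneg (tsum_nonneg fun k => mul_nonneg (hc k) (pow_nonneg hr0 k)),
      ← Complex.norm_real]
    push_cast
    rfl
  have hsub := s0.tsum_sub (s1.mul_left (1 - r))
  rw [e0, tsum_mul_left] at hsub
  rw [e1, e2, ← hsub]
  refine (s0.sub (s1.mul_left _)).tsum_le_tsum (fun k => ?_) s2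
  have hB := one_add_mul_le_pow (a := r - 1) (by linarith) k
  rw [add_sub_cancel] at hB
  nlinarith [mul_le_mul_of_nonneg_left hB (hc k)]

theorem not_isWeightingScheme_of_bounded_derivative {J : Type*} {F : Filter J} [F.NeBot]
    {a : J → ℕ → ℂ} {M : ℝ} (hM : ∀ j, ‖∑' k, a j k * (k : ℂ)‖ ≤ M) :
    ¬ IsWeightingScheme F a := by
  rintro ⟨hrad, hone, hnonneg, hlim⟩
  obtain ⟨j₀⟩ := F.nonempty_of_neBot
  have hM0 : 0 ≤ M := (norm_nonneg _).trans (hM j₀)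
  set t : ℝ := 1 / (2 * (M + 1)) with ht
  have ht0 : 0 < t := by positivity
  have htM : t * (M + 1) = 1 / 2 := by
    rw [ht]
    field_simp
  have ht1 : t ≤ 1 / 2 := by nlinarith
  have hr : ‖((1 - t : ℝ) : ℂ)‖ < 1 := by
    rw [Complex.norm_real, Real.norm_of_nonneg (by linarith)]
    linarith
  have h := (tendsto_zero_iff_norm_tendsto_zero.1 (hlim _ hr)).eventually_lt_const
    (show (0 : ℝ) < 1 / 2 by norm_num)
  obtain ⟨j, hj⟩ := h.exists
  have hlow := one_sub_mul_le_norm_tsum_mul_pow (hrad j) (hone j) (hnonneg j)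
    (r := 1 - t) (by linarith) (by linarith)
  have := mul_le_mul_of_nonneg_left (hM j) ht0.le
  rw [sub_sub_cancel] at hlow
  linarith

theorem not_wsBounded_of_higher_order_pole
    {X : Type*} [NormedAddCommGroup X] [NormedSpace ℂ X] [CompleteSpace X]
    {T : X →L[ℂ] X} (hr : spectralRadius ℂ T = 1) {m : ℕ} (hm : 2 ≤ m)
    (hpole : HasResolventPoleOfOrder T 1 m) : ¬ WSBounded T := by
  rintro ⟨J, F, hF, a, hws, C, hC⟩
  obtain ⟨A, B, hA0, hA, hB⟩ := hpole.exists_jordan_chain hm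
  rw [one_smul] at hA hB
  have hApos : 0 < ‖A‖ := norm_pos_iff.2 hA0
  refine not_isWeightingScheme_of_bounded_derivative (F := F) (M := (C * ‖B‖ + ‖B‖) / ‖A‖)
    (fun j => ?_) hws
  have h := wsApply_mul_of_jordan_chain hr hA hB (hws.1 j)
  rw [hws.2.1 j, one_smul, ← sub_eq_iff_eq_add'] at h
  rw [le_div_iff₀ hApos, ← norm_smul, ← h]
  calc ‖wsApply (a j) T * B - B‖ ≤ ‖wsApply (a j) T * B‖ + ‖B‖ := norm_sub_le _ _
    _ ≤ ‖wsApply (a j) T‖ * ‖B‖ + ‖B‖ := by gcongr; exact norm_mul_le _ _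
    _ ≤ C * ‖B‖ + ‖B‖ := by gcongr; exact hC j

/-- **Proposition 4.9.** Let `X` be a complex Banach space, `T` a bounded operator on `X`
such that `r(T) = 1` is a spectral value of `T` and an `m`-th order pole of the resolvent
(`m ∈ ℕ`, `m ≥ 1`). Then `T` is (WS)-bounded if and only if `m = 1`. -/
theorem wsBounded_iff_first_order_pole
    {X : Type*} [NormedAddCommGroup X] [NormedSpace ℂ X] [CompleteSpace X]
    (T : X →L[ℂ] X) (hr : spectralRadius ℂ T = 1)
    (m : ℕ) (hm : 1 ≤ m) (hpole : HasResolventPoleOfOrder T 1 m) :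
    WSBounded T ↔ m = 1 := by
  constructor
  · intro h
    by_contra hm1
    exact not_wsBounded_of_higher_order_pole hr (by omega) hpole h
  · rintro rfl
    exact wsBounded_of_first_order_pole hr hpole

end
end

section
/- Let T be a positive operator on a complex Banach lattice E with r(T) = 1. If T is (WS)-bounded, then the peripheral spectrum σ(T) ∩ {z ∈ ℂ : |z| = 1} of T is cyclic, i.e. e^{iθ} ∈ σ(T) with θ ∈ ℝ implies e^{inθ} ∈ σ(T) for every n ∈ ℤ. -/
open scoped ComplexOrder ENNReal
open Filter Topology

noncomputable section

/-- A complex Banach lattice: a complex Banach space `E = E_ℝ ⊕ i E_ℝ` which is the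
complexification of a real Banach lattice `E_ℝ` (the set `real`), equipped with the
partial order induced by the positive cone of `E_ℝ` and with the lattice modulus
`|z| = sup_θ |Re (e^{iθ} z)|` (the map `modulus`), whose norm satisfies `‖z‖ = ‖|z|‖`
and is a lattice norm. -/
class ComplexBanachLattice (E : Type*) [NormedAddCommGroup E] [NormedSpace ℂ E]
    [PartialOrder E] where
  /-- The real part `E_ℝ` of `E`. -/
  real : Set E
  real_zero : (0 : E) ∈ real
  real_add : ∀ x ∈ real, ∀ y ∈ real, x + y ∈ real
  real_neg : ∀ x ∈ real, -x ∈ real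
  real_smul : ∀ (r : ℝ), ∀ x ∈ real, (r : ℂ) • x ∈ real
  /-- `E = E_ℝ ⊕ i E_ℝ`. -/
  real_decomp : ∀ z : E, ∃ x ∈ real, ∃ y ∈ real, z = x + Complex.I • y
  /-- Positive elements are real. -/
  nonneg_mem_real : ∀ x : E, 0 ≤ x → x ∈ real
  /-- The order is determined by the positive cone. -/
  le_iff_sub_nonneg : ∀ x y : E, x ≤ y ↔ 0 ≤ y - x
  smul_nonneg : ∀ (r : ℝ), 0 ≤ r → ∀ x : E, 0 ≤ x → 0 ≤ (r : ℂ) • x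
  /-- The real part is a (vector) lattice: binary suprema of real elements exist. -/
  real_sup_exists : ∀ x ∈ real, ∀ y ∈ real, ∃ s ∈ real, IsLUB {x, y} s
  /-- The modulus map `z ↦ |z|`. -/
  modulus : E → E
  modulus_nonneg : ∀ z : E, 0 ≤ modulus z
  modulus_eq_zero_iff : ∀ z : E, modulus z = 0 ↔ z = 0
  modulus_add_le : ∀ z w : E, modulus (z + w) ≤ modulus z + modulus w
  modulus_smul : ∀ (c : ℂ) (z : E), modulus (c • z) = (‖c‖ : ℂ) • modulus z
  /-- On real elements the modulus is the lattice modulus, i.e. the supremum of `x` and `-x`. -/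
  modulus_isLUB : ∀ x ∈ real, IsLUB {x, -x} (modulus x)
  norm_modulus : ∀ z : E, ‖modulus z‖ = ‖z‖
  /-- The norm is a lattice norm. -/
  norm_mono : ∀ x y : E, modulus x ≤ modulus y → ‖x‖ ≤ ‖y‖

/-- The real part `E_ℝ` of a complex Banach lattice. -/
def latticeRealPart (E : Type*) [NormedAddCommGroup E] [NormedSpace ℂ E] [PartialOrder E]
    [ComplexBanachLattice E] : Set E :=
  ComplexBanachLattice.real

/-- A bounded linear operator on a complex Banach lattice is positive if it maps the
positive cone into itself. -/
def IsPositiveOp {E : Type*} [NormedAddCommGroup E] [NormedSpace ℂ E] [PartialOrder E]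
    [ComplexBanachLattice E] (T : E →L[ℂ] E) : Prop :=
  ∀ x : E, 0 ≤ x → 0 ≤ T x

namespace ComplexBanachLattice

variable {E : Type*} [NormedAddCommGroup E] [NormedSpace ℂ E] [PartialOrder E]
  [ComplexBanachLattice E]

instance instIsOrderedAddMonoid : IsOrderedAddMonoid E where
  add_le_add_left x y h z := by
    rw [le_iff_sub_nonneg] at h ⊢
    simpa using h

omit [PartialOrder E] [ComplexBanachLattice E] in
theorem smul_eq_coe_smul (r : ℝ) (x : E) : r • x = (r : ℂ) • x :=
  (Complex.coe_smul r x).symm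

instance instPosSMulMono : PosSMulMono ℝ E where
  smul_le_smul_of_nonneg_left r hr x y h := by
    have hxy : (0 : E) ≤ y - x := (le_iff_sub_nonneg x y).1 h
    have := ComplexBanachLattice.smul_nonneg r hr _ hxy
    rw [le_iff_sub_nonneg, ← smul_sub, smul_eq_coe_smul]
    exact this

instance instSMulPosMono : SMulPosMono ℝ E where
  smul_le_smul_of_nonneg_right x hx r s h := by
    have := ComplexBanachLattice.smul_nonneg (s - r) (sub_nonneg.2 h) _ hx
    rw [le_iff_sub_nonneg, ← sub_smul, smul_eq_coe_smul]
    exact this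

variable (E) in
/-- The real part of a complex Banach lattice as a real subspace. -/
def realPart : Submodule ℝ E where
  carrier := ComplexBanachLattice.real
  zero_mem' := real_zero
  add_mem' {x y} hx hy := real_add x hx y hy
  smul_mem' r x hx := by
    rw [smul_eq_coe_smul]
    exact real_smul r x hx

instance instPosSMulMonoRealPart : PosSMulMono ℝ (realPart E) where
  smul_le_smul_of_nonneg_left r hr x y h := by
    have hxy : (x : E) ≤ y := h
    exact (smul_le_smul_of_nonneg_left hxy hr : r • (x : E) ≤ r • (y : E))

instance instSMulPosMonoRealPart : SMulPosMono ℝ (realPart E) where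
  smul_le_smul_of_nonneg_right x hx r s h := by
    have hx' : (0 : E) ≤ x := hx
    exact (smul_le_smul_of_nonneg_right h hx' : r • (x : E) ≤ s • (x : E))

theorem exists_isLUB_realPart (x y : realPart E) : ∃ s : realPart E, IsLUB {(x : E), (y : E)} s :=
  let ⟨s, hs, h⟩ := real_sup_exists (x : E) x.2 (y : E) y.2
  ⟨⟨s, hs⟩, h⟩

/-- The supremum of two real elements. -/
def realSup (x y : realPart E) : realPart E := (exists_isLUB_realPart x y).choose

theorem isLUB_realSup (x y : realPart E) : IsLUB {(x : E), (y : E)} (realSup x y : E) :=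
  (exists_isLUB_realPart x y).choose_spec

theorem le_realSup_left (x y : realPart E) : x ≤ realSup x y :=
  (isLUB_realSup x y).1 (by simp)

theorem le_realSup_right (x y : realPart E) : y ≤ realSup x y :=
  (isLUB_realSup x y).1 (by simp)

theorem realSup_le {x y z : realPart E} (hx : x ≤ z) (hy : y ≤ z) : realSup x y ≤ z :=
  (isLUB_realSup x y).2 (by
    rintro w (rfl | rfl)
    exacts [hx, hy])

instance instLatticeRealPart : Lattice (realPart E) where
  sup := realSup
  le_sup_left := le_realSup_left
  le_sup_right := le_realSup_right
  sup_le _ _ _ := realSup_le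
  inf x y := -realSup (-x) (-y)
  inf_le_left x y := neg_le.1 (le_realSup_left (-x) (-y))
  inf_le_right x y := neg_le.1 (le_realSup_right (-x) (-y))
  le_inf _ _ _ hx hy := le_neg.1 (realSup_le (neg_le_neg hx) (neg_le_neg hy))

theorem coe_abs (x : realPart E) : ((|x| : realPart E) : E) = modulus (x : E) :=
  (isLUB_realSup x (-x)).unique (modulus_isLUB (x : E) x.2)

theorem mem_realPart_of_nonneg {x : E} (hx : 0 ≤ x) : x ∈ realPart E :=
  nonneg_mem_real x hx

theorem modulus_of_nonneg {x : E} (hx : 0 ≤ x) : modulus x = x := by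
  have h := coe_abs (⟨x, mem_realPart_of_nonneg hx⟩ : realPart E)
  rw [← h, abs_of_nonneg (show (0 : realPart E) ≤ ⟨x, _⟩ from hx)]

theorem norm_le_norm_of_nonneg_of_le {x y : E} (hx : 0 ≤ x) (hxy : x ≤ y) : ‖x‖ ≤ ‖y‖ :=
  norm_mono x y (by rwa [modulus_of_nonneg hx, modulus_of_nonneg (hx.trans hxy)])

theorem modulus_real_smul (r : ℝ) (z : E) : modulus (r • z) = |r| • modulus z := by
  rw [smul_eq_coe_smul, modulus_smul, smul_eq_coe_smul]
  simp

theorem modulus_neg (z : E) : modulus (-z) = modulus z := by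
  simpa using modulus_smul (-1 : ℂ) z

theorem modulus_zero : modulus (0 : E) = 0 := (modulus_eq_zero_iff 0).2 rfl

theorem modulus_sub_le (z w : E) : modulus (z - w) ≤ modulus z + modulus w := by
  simpa [sub_eq_add_neg, modulus_neg] using modulus_add_le z (-w)

theorem modulus_smul_of_norm_eq_one {c : ℂ} (hc : ‖c‖ = 1) (z : E) :
    modulus (c • z) = modulus z := by
  simp [modulus_smul, hc]

theorem modulus_sum_le {ι : Type*} (s : Finset ι) (f : ι → E) :
    modulus (∑ i ∈ s, f i) ≤ ∑ i ∈ s, modulus (f i) := by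
  classical
  induction s using Finset.induction_on with
  | empty => simp [modulus_zero]
  | insert a s ha ih =>
    rw [Finset.sum_insert ha, Finset.sum_insert ha]
    exact (modulus_add_le _ _).trans (by gcongr)

/-- Real Banach lattices are Archimedean. -/
theorem nonpos_of_forall_le_smul {x u : realPart E}
    (h : ∀ ε : ℝ, 0 < ε → x ≤ ε • u) : x ≤ 0 := by
  have hu : ∀ ε : ℝ, 0 < ε → x ⊔ 0 ≤ ε • |u| := fun ε hε =>
    sup_le ((h ε hε).trans (smul_le_smul_of_nonneg_left (le_abs_self u) hε.le))
      (_root_.smul_nonneg hε.le (abs_nonneg u))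
  have hn : ‖((x ⊔ 0 : realPart E) : E)‖ = 0 := by
    refine le_antisymm (le_of_forall_pos_le_add fun η hη => ?_) (norm_nonneg _)
    have hpos : 0 < ‖((|u| : realPart E) : E)‖ + 1 := by positivity
    have h1 := norm_le_norm_of_nonneg_of_le (x := ((x ⊔ 0 : realPart E) : E))
      (show (0 : realPart E) ≤ x ⊔ 0 from le_sup_right)
      (show _ ≤ (((η / (‖((|u| : realPart E) : E)‖ + 1)) • |u| : realPart E) : E) from
        hu _ (by positivity))
    refine h1.trans ?_
    rw [Submodule.coe_smul, norm_smul, Real.norm_of_nonneg (by positivity), zero_add,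
      div_mul_eq_mul_div, div_le_iff₀ hpos]
    nlinarith [norm_nonneg ((|u| : realPart E) : E)]
  have h0 : x ⊔ 0 = 0 := by
    ext
    simpa using hn
  exact h0 ▸ le_sup_left

end ComplexBanachLattice

/-- A discrete intermediate value theorem in lattice ordered groups. -/
theorem le_of_forall_le_abs_of_eq_neg {G : Type*} [Lattice G] [AddCommGroup G]
    [IsOrderedAddMonoid G] {q d : G} (hd : 0 ≤ d) (M : ℕ) (y : ℕ → G)
    (hq : ∀ i ≤ M, q ≤ |y i|) (hy : ∀ i < M, |y (i + 1) - y i| ≤ d) (hM : y M = -y 0) :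
    q ≤ d := by
  let := AddCommGroup.toDistribLattice G
  have inf_neg_le : ∀ a b : G, |b - a| ≤ d → a ⊓ -b ≤ d := by
    intro a b hab
    have h1 : a - b ≤ d := (neg_sub b a) ▸ (neg_le_abs (b - a)).trans hab
    calc a ⊓ -b ≤ (d + b) ⊓ (d + -b) :=
          inf_le_inf (sub_le_iff_le_add.1 h1) (le_add_of_nonneg_left hd)
      _ = d + b ⊓ -b := (add_inf _ _ _).symm
      _ ≤ d := add_le_of_nonpos_right (by
          rw [← neg_nonneg, neg_inf, neg_neg, sup_comm]
          exact abs_nonneg b)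
  have key : ∀ y : ℕ → G, (∀ i ≤ M, q ≤ |y i|) → (∀ i < M, |y (i + 1) - y i| ≤ d) →
      y M = -y 0 → q ⊓ y 0 ≤ d := by
    intro y hq hy hM
    have step : ∀ i ≤ M, q ⊓ y 0 ≤ d ⊔ y i := by
      intro i
      induction i with
      | zero => exact fun _ => inf_le_right.trans le_sup_right
      | succ i ih =>
        intro hi
        have h1 := ih (by omega)
        have h2 : q ⊓ y 0 ≤ y (i + 1) ⊔ -y (i + 1) := inf_le_left.trans (hq _ hi)
        have h3 := inf_neg_le _ _ (hy i (by omega))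
        calc q ⊓ y 0 ≤ (d ⊔ y i) ⊓ (y (i + 1) ⊔ -y (i + 1)) := le_inf h1 h2
          _ = (d ⊔ y i) ⊓ y (i + 1) ⊔ (d ⊓ -y (i + 1) ⊔ y i ⊓ -y (i + 1)) := by
            rw [inf_sup_left (d ⊔ y i), inf_sup_right d (y i) (-y (i + 1))]
          _ ≤ d ⊔ y (i + 1) :=
            sup_le (inf_le_right.trans le_sup_right)
              (sup_le (inf_le_left.trans le_sup_left) (h3.trans le_sup_left))
    have h0 : y 0 ⊓ -y 0 ≤ d := inf_neg_le _ _ (by simpa using hd)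
    calc q ⊓ y 0 ≤ (d ⊔ y M) ⊓ y 0 := le_inf (step M le_rfl) inf_le_right
      _ = d ⊓ y 0 ⊔ y 0 ⊓ -y 0 := by rw [inf_sup_right, hM, inf_comm (-y 0)]
      _ ≤ d := sup_le inf_le_left h0
  have h1 := key y hq hy hM
  have h2 := key (fun i => -y i) (by simpa using hq)
    (fun i hi => by
      rw [← abs_neg]
      simpa [add_comm, sub_eq_add_neg] using hy i hi) (by simp [hM])
  calc q ≤ q ⊓ (y 0 ⊔ -y 0) := le_inf le_rfl (hq 0 (Nat.zero_le _))
    _ = q ⊓ y 0 ⊔ q ⊓ -y 0 := inf_sup_left _ _ _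
    _ ≤ d := sup_le h1 h2

namespace ComplexBanachLattice

variable {E : Type*} [NormedAddCommGroup E] [NormedSpace ℂ E] [PartialOrder E]
  [ComplexBanachLattice E]

theorem le_of_sub_eq {G : Type*} [AddCommGroup G] [PartialOrder G] [IsOrderedAddMonoid G]
    {a b c : G} (hc : 0 ≤ c) (h : b - a = c) : a ≤ b :=
  sub_nonneg.1 (h ▸ hc)

/-- The modulus as a map into the real part. -/
def realModulus (z : E) : realPart E := ⟨modulus z, mem_realPart_of_nonneg (modulus_nonneg z)⟩

@[simp] theorem coe_realModulus (z : E) : (realModulus z : E) = modulus z := rfl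

/-- The real part of `e^{-iθ} (x + i y)`. -/
def rotate (x y : realPart E) (θ : ℝ) : realPart E := Real.cos θ • x + Real.sin θ • y

theorem exp_smul_rotate (x y : realPart E) (θ : ℝ) :
    Complex.exp (θ * Complex.I) •
      ((rotate x y θ : E) + Complex.I • (rotate x y (θ + Real.pi / 2) : E)) =
      (x : E) + Complex.I • (y : E) := by
  simp only [rotate, Submodule.coe_add, Submodule.coe_smul, Real.cos_add_pi_div_two,
    Real.sin_add_pi_div_two, smul_eq_coe_smul, smul_add, smul_smul, Complex.exp_mul_I]
  have h : (Complex.cos θ) ^ 2 + (Complex.sin θ) ^ 2 = 1 := Complex.cos_sq_add_sin_sq θ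
  have hI : Complex.I ^ 2 = -1 := Complex.I_sq
  push_cast
  match_scalars
  · linear_combination h - (Complex.sin θ) ^ 2 * hI
  · linear_combination Complex.I * h + Complex.cos θ * Complex.sin θ * hI

theorem modulus_rotate (x y : realPart E) (θ : ℝ) :
    modulus ((rotate x y θ : E) + Complex.I • (rotate x y (θ + Real.pi / 2) : E)) =
      modulus ((x : E) + Complex.I • (y : E)) := by
  rw [← exp_smul_rotate x y θ, modulus_smul_of_norm_eq_one (Complex.norm_exp_ofReal_mul_I θ)]

theorem modulus_I_smul (z : E) : modulus (Complex.I • z) = modulus z :=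
  modulus_smul_of_norm_eq_one Complex.norm_I z

theorem realModulus_le_rotate (x y : realPart E) (θ : ℝ) :
    realModulus ((x : E) + Complex.I • (y : E)) ≤
      |rotate x y θ| + |rotate x y (θ + Real.pi / 2)| := by
  have h := modulus_add_le (rotate x y θ : E) (Complex.I • (rotate x y (θ + Real.pi / 2) : E))
  rw [modulus_rotate, modulus_I_smul, ← coe_abs, ← coe_abs] at h
  exact h

theorem abs_rotate_le (x y : realPart E) (θ : ℝ) :
    |rotate x y θ| ≤ realModulus ((x : E) + Complex.I • (y : E)) +
      |rotate x y (θ + Real.pi / 2)| := by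
  have h := modulus_sub_le
    ((rotate x y θ : E) + Complex.I • (rotate x y (θ + Real.pi / 2) : E))
    (Complex.I • (rotate x y (θ + Real.pi / 2) : E))
  rw [modulus_rotate, modulus_I_smul, add_sub_cancel_right, ← coe_abs, ← coe_abs] at h
  exact h

theorem abs_real_smul (r : ℝ) (x : realPart E) : |r • x| = |r| • |x| := by
  ext
  rw [coe_abs, Submodule.coe_smul, Submodule.coe_smul, modulus_real_smul, coe_abs]

theorem abs_smul_le {r s : ℝ} (h : |r| ≤ s) (x : realPart E) : |r • x| ≤ s • |x| :=
  (abs_real_smul r x).trans_le (smul_le_smul_of_nonneg_right h (abs_nonneg x))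

theorem abs_rotate_sub_rotate_le (x y : realPart E) (s t : ℝ) :
    |rotate x y s - rotate x y t| ≤ |s - t| • (|x| + |y|) := by
  have h : rotate x y s - rotate x y t =
      (Real.cos s - Real.cos t) • x + (Real.sin s - Real.sin t) • y := by
    simp only [rotate]
    module
  rw [h, smul_add]
  refine (abs_add_le _ _).trans (add_le_add (abs_smul_le ?_ x) (abs_smul_le ?_ y))
  · exact Real.abs_cos_sub_cos_le s t
  · exact Real.abs_sin_sub_sin_le s t

theorem rotate_add_pi (x y : realPart E) (s : ℝ) : rotate x y (s + Real.pi) = -rotate x y s := by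
  simp only [rotate, Real.cos_add_pi, Real.sin_add_pi]
  module

/-- If `q` is below all `|rotate x y (i π / M + π / 2)|`, then `q` is small. -/
theorem le_of_forall_le_abs_rotate {q x y : realPart E} {M : ℕ} (hM : 0 < M)
    (hq : ∀ i ≤ M, q ≤ |rotate x y (i * (Real.pi / M) + Real.pi / 2)|) :
    q ≤ (Real.pi / M) • (|x| + |y|) := by
  have hM' : (M : ℝ) ≠ 0 := by positivity
  refine le_of_forall_le_abs_of_eq_neg (_root_.smul_nonneg (by positivity)
    (add_nonneg (abs_nonneg x) (abs_nonneg y))) M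
    (fun i => rotate x y (i * (Real.pi / M) + Real.pi / 2)) hq (fun i _ => ?_) ?_
  · refine (abs_rotate_sub_rotate_le x y _ _).trans_eq ?_
    congr 1
    push_cast
    rw [show ((i : ℝ) + 1) * (Real.pi / M) + Real.pi / 2 - (i * (Real.pi / M) + Real.pi / 2) =
      Real.pi / M by ring, abs_of_nonneg (by positivity)]
  · rw [← rotate_add_pi]
    congr 1
    field_simp
    push_cast
    ring

theorem exists_nat_pi_div_le {ε : ℝ} (hε : 0 < ε) : ∃ M : ℕ, 0 < M ∧ Real.pi / M ≤ ε := by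
  obtain ⟨M, hM⟩ := exists_nat_gt (Real.pi / ε)
  have hM0 : (0 : ℝ) < M := lt_trans (by positivity) hM
  refine ⟨M, by exact_mod_cast hM0, ?_⟩
  rw [div_lt_iff₀ hε] at hM
  rw [div_le_iff₀ hM0]
  linarith

theorem abs_le_realModulus (x y : realPart E) :
    |x| ≤ realModulus ((x : E) + Complex.I • (y : E)) := by
  refine sub_nonpos.1 (nonpos_of_forall_le_smul (u := (2 : ℝ) • (|x| + |y|)) fun ε hε => ?_)
  obtain ⟨M, hM, hMε⟩ := exists_nat_pi_div_le hε
  have key := le_of_forall_le_abs_rotate (q := (1 / 2 : ℝ) •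
    (|x| - realModulus ((x : E) + Complex.I • (y : E)))) (x := x) (y := y) hM (fun i _ => ?_)
  · have h1 : (Real.pi / M) • (|x| + |y|) ≤ ε • (|x| + |y|) :=
      smul_le_smul_of_nonneg_right hMε (add_nonneg (abs_nonneg x) (abs_nonneg y))
    have h2 := smul_le_smul_of_nonneg_left (key.trans h1) (zero_le_two (α := ℝ))
    exact le_of_sub_eq (sub_nonneg.2 h2) (by module)
  · set θ : ℝ := i * (Real.pi / M)
    have h1 : x = Real.cos θ • rotate x y θ + (-Real.sin θ) • rotate x y (θ + Real.pi / 2) := by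
      simp only [rotate, Real.cos_add_pi_div_two, Real.sin_add_pi_div_two]
      match_scalars
      · linear_combination -Real.cos_sq_add_sin_sq θ
      · ring
    have h2 : |x| ≤ |rotate x y θ| + |rotate x y (θ + Real.pi / 2)| := by
      calc |x| ≤ |Real.cos θ • rotate x y θ| + |(-Real.sin θ) • rotate x y (θ + Real.pi / 2)| := by
            conv_lhs => rw [h1]
            exact abs_add_le _ _
        _ ≤ (1 : ℝ) • |rotate x y θ| + (1 : ℝ) • |rotate x y (θ + Real.pi / 2)| :=
            add_le_add (abs_smul_le (Real.abs_cos_le_one θ) _)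
              (abs_smul_le (by rw [abs_neg]; exact Real.abs_sin_le_one θ) _)
        _ = _ := by rw [one_smul, one_smul]
    have h3 := h2.trans (add_le_add_left (abs_rotate_le x y θ) _)
    have h4 := _root_.smul_nonneg (by norm_num : (0 : ℝ) ≤ 1 / 2) (sub_nonneg.2 h3)
    exact le_of_sub_eq h4 (by module)

theorem exists_realPart_add_I_smul (z : E) : ∃ x : realPart E, ∃ y : realPart E,
    (x : E) + Complex.I • (y : E) = z := by
  obtain ⟨x, hx, y, hy, h⟩ := real_decomp z
  exact ⟨⟨x, hx⟩, ⟨y, hy⟩, h.symm⟩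

theorem eq_of_add_I_smul_eq {x y x' y' : realPart E}
    (h : (x : E) + Complex.I • (y : E) = (x' : E) + Complex.I • (y' : E)) : x = x' := by
  have h0 : ((x - x' : realPart E) : E) + Complex.I • ((y - y' : realPart E) : E) = 0 := by
    rw [Submodule.coe_sub, Submodule.coe_sub, smul_sub, ← sub_eq_zero.2 h]
    abel
  have h1 := abs_le_realModulus (x - x') (y - y')
  rw [h0] at h1
  have h2 : realModulus (0 : E) = 0 := Subtype.ext modulus_zero
  rw [h2] at h1
  exact sub_eq_zero.1 (le_antisymm ((le_abs_self _).trans h1)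
    (neg_nonpos.1 ((neg_le_abs _).trans h1)))

/-- The real part of an element, as a real linear map. -/
def reL : E →ₗ[ℝ] realPart E where
  toFun z := (exists_realPart_add_I_smul z).choose
  map_add' z w := by
    obtain ⟨y, hy⟩ := (exists_realPart_add_I_smul z).choose_spec
    obtain ⟨y', hy'⟩ := (exists_realPart_add_I_smul w).choose_spec
    obtain ⟨y'', hy''⟩ := (exists_realPart_add_I_smul (z + w)).choose_spec
    refine eq_of_add_I_smul_eq (y := y'') (y' := y + y') ?_
    rw [hy'', Submodule.coe_add, Submodule.coe_add, smul_add]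
    conv_lhs => rw [← hy, ← hy']
    abel
  map_smul' r z := by
    obtain ⟨y, hy⟩ := (exists_realPart_add_I_smul z).choose_spec
    obtain ⟨y', hy'⟩ := (exists_realPart_add_I_smul (r • z)).choose_spec
    refine eq_of_add_I_smul_eq (y := y') (y' := r • y) ?_
    rw [hy', RingHom.id_apply, Submodule.coe_smul, Submodule.coe_smul, smul_comm Complex.I r,
      ← smul_add, hy]

theorem reL_add_I_smul (x y : realPart E) : reL ((x : E) + Complex.I • (y : E)) = x := by
  obtain ⟨y', hy'⟩ := (exists_realPart_add_I_smul ((x : E) + Complex.I • (y : E))).choose_spec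
  exact eq_of_add_I_smul_eq hy'

theorem reL_coe (x : realPart E) : reL (x : E) = x := by
  simpa using reL_add_I_smul x 0

theorem abs_reL_le (z : E) : |reL z| ≤ realModulus z := by
  obtain ⟨x, y, rfl⟩ := exists_realPart_add_I_smul z
  rw [reL_add_I_smul]
  exact abs_le_realModulus x y

theorem reL_smul_le (c : ℂ) (z : E) : (reL (c • z) : E) ≤ ‖c‖ • modulus z := by
  have h : (reL (c • z) : E) ≤ modulus (c • z) := (le_abs_self _).trans (abs_reL_le (c • z))
  rwa [modulus_smul, ← smul_eq_coe_smul] at h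

theorem reL_exp_smul (x y : realPart E) (θ : ℝ) :
    reL (Complex.exp (-(θ * Complex.I)) • ((x : E) + Complex.I • (y : E))) = rotate x y θ := by
  rw [← exp_smul_rotate x y θ, smul_smul, ← Complex.exp_add]
  simp [reL_add_I_smul]

/-- An element of the unit circle. -/
def circlePoint (M i : ℕ) : ℂ := Complex.exp (((i * (Real.pi / M) : ℝ) : ℂ) * Complex.I)

theorem norm_circlePoint (M i : ℕ) : ‖circlePoint M i‖ = 1 := Complex.norm_exp_ofReal_mul_I _

theorem modulus_le_of_finite {M : ℕ} (hM : 0 < M) {q z : E} (hq : q ∈ realPart E)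
    (h : ∀ i ≤ 2 * M, (reL ((circlePoint M i)⁻¹ • z) : E) ≤ q) :
    (1 - 2 * (Real.pi / M)) • modulus z ≤ q := by
  obtain ⟨x, y, rfl⟩ := exists_realPart_add_I_smul z
  set z : E := (x : E) + Complex.I • (y : E)
  lift q to realPart E using hq
  have h' : ∀ i ≤ 2 * M, rotate x y (i * (Real.pi / M)) ≤ q := by
    intro i hi
    have := h i hi
    rw [circlePoint, ← Complex.exp_neg, reL_exp_smul] at this
    exact this
  have key := le_of_forall_le_abs_rotate (q := realModulus z - q) (x := x) (y := y) hM ?_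
  · have hx : |x| ≤ realModulus z := abs_le_realModulus x y
    have hy : |y| ≤ realModulus z := by
      have h1 := abs_reL_le ((-Complex.I) • z)
      have h2 : (-Complex.I) • z = (y : E) + Complex.I • ((-x : realPart E) : E) := by
        simp only [z, Submodule.coe_neg, smul_add, smul_smul, smul_neg]
        rw [neg_mul, Complex.I_mul_I]
        module
      have h3 : realModulus ((-Complex.I) • z) = realModulus z :=
        Subtype.ext (modulus_smul_of_norm_eq_one (by simp) z)
      rwa [h3, h2, reL_add_I_smul] at h1
    have h1 := key.trans (smul_le_smul_of_nonneg_left (add_le_add hx hy)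
      (by positivity : 0 ≤ Real.pi / M))
    have h2 : (1 - 2 * (Real.pi / M)) • realModulus z ≤ q := by
      exact le_of_sub_eq (sub_nonneg.2 h1) (by module)
    exact h2
  · intro i hi
    have h1 := realModulus_le_rotate x y (i * (Real.pi / M))
    have h2 : |rotate x y (i * (Real.pi / M))| ≤ q := by
      refine abs_le'.2 ⟨h' i (by omega), ?_⟩
      have h3 := h' (i + M) (by omega)
      have h4 : ((i + M : ℕ) : ℝ) * (Real.pi / M) = i * (Real.pi / M) + Real.pi := by
        have : (M : ℝ) ≠ 0 := by positivity
        push_cast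
        field_simp
      rwa [h4, rotate_add_pi] at h3
    exact sub_le_iff_le_add'.2 (h1.trans (add_le_add_left h2 _))

/-- The modulus is the supremum of the real parts of the rotated element. -/
theorem modulus_le {q z : E} (hq : q ∈ realPart E)
    (h : ∀ α : ℂ, ‖α‖ = 1 → (reL (α • z) : E) ≤ q) : modulus z ≤ q := by
  lift q to realPart E using hq
  have key : realModulus z - q ≤ 0 := by
    refine nonpos_of_forall_le_smul (u := (2 : ℝ) • realModulus z) fun ε hε => ?_
    obtain ⟨M, hM, hMε⟩ := exists_nat_pi_div_le hε
    have h1 : (1 - 2 * (Real.pi / M)) • realModulus z ≤ q :=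
      modulus_le_of_finite hM q.2 (fun i _ => h _ (by simp [norm_circlePoint]))
    have h2 : (Real.pi / M) • (2 : ℝ) • realModulus z ≤ ε • (2 : ℝ) • realModulus z :=
      smul_le_smul_of_nonneg_right hMε
        (_root_.smul_nonneg zero_le_two (show (0 : E) ≤ modulus z from modulus_nonneg z))
    refine le_trans ?_ h2
    exact le_of_sub_eq (sub_nonneg.2 h1) (by module)
  exact sub_nonpos.1 key

/-- Bounded positive operators commute with taking real parts. -/
theorem reL_apply_of_isPositiveOp {T : E →L[ℂ] E} (hT : IsPositiveOp T) (z : E) :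
    (reL (T z) : E) = T (reL z) := by
  have hreal : ∀ x : realPart E, T x ∈ realPart E := by
    intro x
    have h1 : (x : E) = (x⁺ : realPart E) - (x⁻ : realPart E) := by
      rw [← Submodule.coe_sub, posPart_sub_negPart]
    rw [h1, map_sub]
    exact sub_mem
      (mem_realPart_of_nonneg (hT _ (show (0 : realPart E) ≤ x⁺ from posPart_nonneg x)))
      (mem_realPart_of_nonneg (hT _ (show (0 : realPart E) ≤ x⁻ from negPart_nonneg x)))
  obtain ⟨x, y, rfl⟩ := exists_realPart_add_I_smul z
  rw [reL_add_I_smul, map_add, map_smul]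
  exact congrArg Subtype.val (reL_add_I_smul ⟨T x, hreal x⟩ ⟨T y, hreal y⟩)

theorem apply_le_apply {T : E →L[ℂ] E} (hT : IsPositiveOp T) {x y : E} (h : x ≤ y) :
    T x ≤ T y := by
  rw [← sub_nonneg] at h ⊢
  simpa using hT _ h

theorem modulus_apply_le {T : E →L[ℂ] E} (hT : IsPositiveOp T) (z : E) :
    modulus (T z) ≤ T (modulus z) := by
  refine modulus_le (mem_realPart_of_nonneg (hT _ (modulus_nonneg z))) fun α hα => ?_
  rw [← map_smul, reL_apply_of_isPositiveOp hT]
  refine apply_le_apply hT ?_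
  simpa [hα] using reL_smul_le α z

end ComplexBanachLattice

/-- A finite Riesz decomposition property. -/
theorem exists_sum_eq_of_le_sum {G ι : Type*} [Lattice G] [AddCommGroup G]
    [IsOrderedAddMonoid G] (s : Finset ι) (b : ι → G) (hb : ∀ i, 0 ≤ b i) {p : G}
    (hp : 0 ≤ p) (hpb : p ≤ ∑ i ∈ s, b i) :
    ∃ g : ι → G, (∀ i, 0 ≤ g i) ∧ (∀ i, g i ≤ b i) ∧ ∑ i ∈ s, g i = p := by
  classical
  induction s using Finset.induction_on generalizing p with
  | empty =>
    refine ⟨fun _ => 0, fun _ => le_rfl, hb, ?_⟩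
    rw [Finset.sum_empty] at hpb ⊢
    exact le_antisymm hp hpb
  | insert a s ha ih =>
    rw [Finset.sum_insert ha] at hpb
    obtain ⟨g, hg0, hgb, hgs⟩ := ih (p := p - p ⊓ b a) (sub_nonneg.2 inf_le_left) (by
      rw [sub_le_iff_le_add, add_inf]
      exact le_inf (le_add_of_nonneg_left (Finset.sum_nonneg fun i _ => hb i))
        (by rwa [add_comm]))
    refine ⟨Function.update g a (p ⊓ b a), fun i => ?_, fun i => ?_, ?_⟩
    · rcases eq_or_ne i a with rfl | h
      · simpa using ⟨hp, hb i⟩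
      · simpa [h] using hg0 i
    · rcases eq_or_ne i a with rfl | h
      · simp
      · simpa [h] using hgb i
    · rw [Finset.sum_insert ha, Finset.sum_update_of_notMem ha, hgs]
      simp

theorem norm_zpow_sub_zpow_le {a b : ℂ} (ha : ‖a‖ = 1) (hb : ‖b‖ = 1) (m : ℤ) :
    ‖a ^ m - b ^ m‖ ≤ |(m : ℝ)| * ‖a - b‖ := by
  have hnat : ∀ k : ℕ, ‖a ^ k - b ^ k‖ ≤ k * ‖a - b‖ := by
    intro k
    induction k with
    | zero => simp
    | succ k ih =>
      have h : a ^ (k + 1) - b ^ (k + 1) = (a ^ k - b ^ k) * a + b ^ k * (a - b) := by ring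
      rw [h]
      refine (norm_add_le _ _).trans ?_
      rw [norm_mul, norm_mul, norm_pow, ha, hb, one_pow, mul_one, one_mul]
      push_cast
      linarith
  obtain ⟨k, rfl | rfl⟩ := m.eq_nat_or_neg
  · simpa using hnat k
  · have ha0 : a ^ k ≠ 0 := pow_ne_zero _ (norm_ne_zero_iff.1 (by simp [ha]))
    have hb0 : b ^ k ≠ 0 := pow_ne_zero _ (norm_ne_zero_iff.1 (by simp [hb]))
    rw [zpow_neg, zpow_neg, zpow_natCast, zpow_natCast, inv_sub_inv ha0 hb0, norm_div, norm_mul,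
      norm_pow, norm_pow, ha, hb, norm_sub_rev]
    simpa using hnat k

namespace ComplexBanachLattice

variable {E : Type*} [NormedAddCommGroup E] [NormedSpace ℂ E] [PartialOrder E]
  [ComplexBanachLattice E]

/-- A partition of the modulus of `z` into pieces on which `z` has nearly constant phase. -/
theorem exists_partition {δ : ℝ} (hδ : 0 < δ) {M : ℕ} (hM : 0 < M)
    (hMδ : 2 * (Real.pi / M) ≤ δ / 2) (z : E) :
    ∃ g : ℕ → E, (∀ i, 0 ≤ g i) ∧ (∑ i ∈ Finset.range (2 * M + 1), g i = modulus z) ∧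
      ∀ i, ∀ a : ℂ, ‖a‖ = 1 → ‖(circlePoint M i)⁻¹ + a‖ ≤ 2 - δ →
        g i ≤ (2 / δ) • (modulus z - reL (a • z)) := by
  set b : ℕ → realPart E := fun i =>
    (reL ((circlePoint M i)⁻¹ • z) - (1 - δ) • realModulus z) ⊔ 0 with hb
  have hb0 : ∀ i, 0 ≤ b i := fun i => le_sup_right
  have hz0 : 0 ≤ realModulus z := modulus_nonneg z
  have hsum : (1 - 2 * (Real.pi / M)) • realModulus z ≤
      (1 - δ) • realModulus z + ∑ i ∈ Finset.range (2 * M + 1), b i := by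
    refine modulus_le_of_finite hM
      ((1 - δ) • realModulus z + ∑ i ∈ Finset.range (2 * M + 1), b i).2 fun i hi => ?_
    have h1 : reL ((circlePoint M i)⁻¹ • z) ≤ (1 - δ) • realModulus z + b i :=
      sub_le_iff_le_add'.1 le_sup_left
    have h2 : b i ≤ ∑ i ∈ Finset.range (2 * M + 1), b i :=
      Finset.single_le_sum (fun i _ => hb0 i) (Finset.mem_range.2 (by omega))
    exact h1.trans (add_le_add_right h2 _)
  have hsum' : realModulus z ≤ ∑ i ∈ Finset.range (2 * M + 1), (2 / δ) • b i := by
    rw [← Finset.smul_sum]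
    have h1 : (δ / 2) • realModulus z ≤ ∑ i ∈ Finset.range (2 * M + 1), b i := by
      have h2 : 0 ≤ (δ / 2 - 2 * (Real.pi / M)) • realModulus z :=
        _root_.smul_nonneg (sub_nonneg.2 hMδ) hz0
      exact le_of_sub_eq (add_nonneg (sub_nonneg.2 hsum) h2) (by module)
    have h3 := smul_le_smul_of_nonneg_left h1 (by positivity : 0 ≤ 2 / δ)
    rwa [smul_smul, div_mul_div_cancel₀ (by positivity), div_self two_ne_zero, one_smul] at h3
  obtain ⟨g, hg0, hgb, hgs⟩ := exists_sum_eq_of_le_sum _ _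
    (fun i => _root_.smul_nonneg (by positivity) (hb0 i)) hz0 hsum'
  refine ⟨fun i => g i, hg0, ?_, fun i a ha hai => ?_⟩
  · rw [← coe_realModulus, ← hgs]
    simp
  · have h1 : b i ≤ realModulus z - reL (a • z) := by
      refine sup_le ?_ ?_
      · have h2 : (reL (((circlePoint M i)⁻¹ + a) • z) : E) ≤ (2 - δ) • modulus z :=
          (reL_smul_le _ z).trans (smul_le_smul_of_nonneg_right hai (modulus_nonneg z))
        rw [add_smul, map_add] at h2
        have h3 : reL ((circlePoint M i)⁻¹ • z) + reL (a • z) ≤ (2 - δ) • realModulus z := h2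
        exact le_of_sub_eq (sub_nonneg.2 h3) (by module)
      · have h2 := reL_smul_le a z
        rw [ha, one_smul] at h2
        exact sub_nonneg.2 (show reL (a • z) ≤ realModulus z from h2)
    exact (hgb i).trans (smul_le_smul_of_nonneg_left h1 (by positivity))

theorem exists_near_power (m : ℤ) {ε : ℝ} (hε : 0 < ε) :
    ∃ C : ℝ, 0 ≤ C ∧ ∃ (s : Finset ℕ) (h : ℕ → ℂ), (∀ i, ‖h i‖ = 1) ∧
      ∀ z : E, ∃ g : ℕ → E, (∀ i, 0 ≤ g i) ∧ (∑ i ∈ s, g i = modulus z) ∧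
        ∀ a : ℂ, ‖a‖ = 1 → ∑ i ∈ s, ‖h i - a ^ m‖ • g i ≤
          ε • modulus z + C • (modulus z - reL (a • z)) := by
  set η : ℝ := ε / (|(m : ℝ)| + 1) with hη
  have hη0 : 0 < η := by positivity
  set δ : ℝ := η ^ 2 / 4 with hδ
  have hδ0 : 0 < δ := by positivity
  obtain ⟨M, hM, hMδ⟩ := exists_nat_pi_div_le (show 0 < δ / 4 by positivity)
  have hu : ∀ i, ‖(circlePoint M i)⁻¹‖ = 1 := fun i => by simp [norm_circlePoint]
  refine ⟨(2 * M + 1 : ℕ) * (2 * (2 / δ)), by positivity, Finset.range (2 * M + 1),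
    fun i => ((circlePoint M i)⁻¹) ^ m, fun i => by rw [norm_zpow, hu, one_zpow], fun z => ?_⟩
  obtain ⟨g, hg0, hgs, hga⟩ := exists_partition hδ0 hM (by linarith) z
  refine ⟨g, hg0, hgs, fun a ha => ?_⟩
  have hr : 0 ≤ modulus z - reL (a • z) := by
    have h2 := reL_smul_le a z
    rw [ha, one_smul] at h2
    exact sub_nonneg.2 h2
  have hi : ∀ i, ‖((circlePoint M i)⁻¹) ^ m - a ^ m‖ • g i ≤
      ε • g i + (2 * (2 / δ)) • (modulus z - reL (a • z)) := by
    intro i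
    rcases le_or_gt ‖(circlePoint M i)⁻¹ + a‖ (2 - δ) with hfar | hnear
    · have h1 : ‖((circlePoint M i)⁻¹) ^ m - a ^ m‖ ≤ 2 := by
        refine (norm_sub_le _ _).trans ?_
        rw [norm_zpow, norm_zpow, hu, ha, one_zpow]
        norm_num
      calc _ ≤ (2 : ℝ) • g i := smul_le_smul_of_nonneg_right h1 (hg0 i)
        _ ≤ (2 : ℝ) • (2 / δ) • (modulus z - reL (a • z)) :=
          smul_le_smul_of_nonneg_left (hga i a ha hfar) zero_le_two
        _ = (2 * (2 / δ)) • (modulus z - reL (a • z)) := smul_smul _ _ _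
        _ ≤ _ := le_add_of_nonneg_left (_root_.smul_nonneg hε.le (hg0 i))
    · refine le_add_of_le_of_nonneg ?_ (_root_.smul_nonneg (by positivity) hr)
      refine smul_le_smul_of_nonneg_right ?_ (hg0 i)
      have hpar := parallelogram_law_with_norm ℝ (circlePoint M i)⁻¹ a
      rw [hu, ha] at hpar
      have h3 : ‖(circlePoint M i)⁻¹ - a‖ ≤ η := by
        refine le_of_sq_le_sq ?_ hη0.le
        rcases le_or_gt δ 2 with h | h
        · nlinarith
        · nlinarith [norm_nonneg ((circlePoint M i)⁻¹ + a), sq_nonneg ‖(circlePoint M i)⁻¹ + a‖]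
      calc _ ≤ |(m : ℝ)| * ‖(circlePoint M i)⁻¹ - a‖ := norm_zpow_sub_zpow_le (hu i) ha m
        _ ≤ (|(m : ℝ)| + 1) * η := by gcongr; linarith
        _ = ε := by rw [hη]; field_simp
  calc _ ≤ ∑ i ∈ Finset.range (2 * M + 1),
        (ε • g i + (2 * (2 / δ)) • (modulus z - reL (a • z))) := Finset.sum_le_sum fun i _ => hi i
    _ = _ := by
      rw [Finset.sum_add_distrib, ← Finset.smul_sum, hgs, Finset.sum_const, Finset.card_range,
        mul_smul ((2 * M + 1 : ℕ) : ℝ), Nat.cast_smul_eq_nsmul]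

/-- If `T |z| ≈ |z|` and `T z ≈ μ z`, then `T w ≈ μ ^ n w` for some `w` with `|w| ≈ |z|`. -/
theorem exists_approx_eigenvector_zpow {T : E →L[ℂ] E} (hT : IsPositiveOp T) {μ : ℂ}
    (hμ : ‖μ‖ = 1) (n : ℤ) {ε : ℝ} (hε : 0 < ε) :
    ∃ C : ℝ, 0 ≤ C ∧ ∀ z : E, ∃ w : E, modulus w ≤ modulus z ∧
      modulus z ≤ modulus w + ε • modulus z ∧
      modulus (T w - μ ^ n • w) ≤ (2 * ε) • modulus z +
        C • (modulus (T (modulus z) - modulus z) + modulus (T z - μ • z)) := by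
  obtain ⟨C, hC, s, h, hh, hg⟩ := exists_near_power (E := E) (-n) hε
  refine ⟨1 + ε + C, by positivity, fun z => ?_⟩
  obtain ⟨g, hg0, hgs, hga⟩ := hg z
  set p := modulus z with hp
  have hp0 : 0 ≤ p := modulus_nonneg z
  set P := modulus (T p - p) with hP
  set Q := modulus (T z - μ • z) with hQ
  have hP0 : 0 ≤ P := modulus_nonneg _
  have hQ0 : 0 ≤ Q := modulus_nonneg _
  set w : E := ∑ i ∈ s, h i • g i with hw
  have hsub : ∀ a : ℂ, w - a • p = ∑ i ∈ s, (h i - a) • g i := by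
    intro a
    rw [hw, ← hgs, Finset.smul_sum, ← Finset.sum_sub_distrib]
    simp only [sub_smul]
  have hmod : ∀ (c : ℂ) (x : E), 0 ≤ x → modulus (c • x) = ‖c‖ • x := by
    intro c x hx
    rw [modulus_smul, modulus_of_nonneg hx, smul_eq_coe_smul]
  have hwle : ∀ a : ℂ, ‖a‖ = 1 → modulus (w - a ^ (-n) • p) ≤ ε • p + C • (p - reL (a • z)) := by
    intro a ha
    rw [hsub]
    refine (modulus_sum_le _ _).trans (le_trans (le_of_eq ?_) (hga a ha))
    exact Finset.sum_congr rfl fun i _ => hmod _ _ (hg0 i)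
  have hreal : ∀ x : E, 0 ≤ x → x ∈ realPart E := fun x hx => mem_realPart_of_nonneg hx
  have hTp : T p ≤ p + P := by
    have h1 : (⟨T p, hreal _ (hT p hp0)⟩ - ⟨p, hreal _ hp0⟩ : realPart E) ≤ _ := le_abs_self _
    have h2 : T p - p ≤ P := by
      have h3 := coe_abs (⟨T p, hreal _ (hT p hp0)⟩ - ⟨p, hreal _ hp0⟩ : realPart E)
      rw [hP]
      exact le_trans h1 h3.le
    exact sub_le_iff_le_add'.1 h2
  have hTwle : ∀ a : ℂ, ‖a‖ = 1 → modulus (T w - a ^ (-n) • T p) ≤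
      ε • T p + C • (T p - reL (a • T z)) := by
    intro a ha
    have h1 : modulus (T w - a ^ (-n) • T p) ≤ T (∑ i ∈ s, ‖h i - a ^ (-n)‖ • g i) := by
      rw [← map_smul, ← map_sub, hsub, map_sum, map_sum]
      refine (modulus_sum_le _ _).trans (le_of_eq (Finset.sum_congr rfl fun i _ => ?_))
      rw [map_smul, hmod _ _ (hT _ (hg0 i)), smul_eq_coe_smul, smul_eq_coe_smul, map_smul]
    refine (h1.trans (apply_le_apply hT (hga a ha))).trans (le_of_eq ?_)
    rw [map_add, smul_eq_coe_smul ε p, smul_eq_coe_smul C, map_smul, map_smul, map_sub,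
      ← reL_apply_of_isPositiveOp hT, map_smul T a z, smul_eq_coe_smul ε, smul_eq_coe_smul C]
  have hmain : ∀ b : ℂ, ‖b‖ = 1 → modulus (T w - μ ^ n • w) ≤
      (2 * ε) • p + (1 + ε + C) • (P + Q) + (2 * C) • (p - reL (b • z)) := by
    intro b hb
    have hμ0 : μ ≠ 0 := norm_ne_zero_iff.1 (by simp [hμ])
    set a : ℂ := b * μ⁻¹ with ha
    have ha1 : ‖a‖ = 1 := by simp [ha, hb, hμ]
    have hab : a ^ (-n) = μ ^ n * b ^ (-n) := by
      rw [ha, mul_zpow, inv_zpow, zpow_neg μ, inv_inv, mul_comm]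
    have h1 := hTwle a ha1
    have h2 : modulus (a ^ (-n) • (T p - p)) = P :=
      modulus_smul_of_norm_eq_one (by rw [norm_zpow, ha1, one_zpow]) _
    have h3 : modulus (μ ^ n • (w - b ^ (-n) • p)) ≤ ε • p + C • (p - reL (b • z)) := by
      rw [modulus_smul_of_norm_eq_one (by rw [norm_zpow, hμ, one_zpow])]
      exact hwle b hb
    have h4 : (reL (b • z) : E) - Q ≤ reL (a • T z) := by
      have h5 : (reL (a • (μ • z - T z)) : E) ≤ Q := by
        have := reL_smul_le a (μ • z - T z)
        rwa [ha1, one_smul, ← modulus_neg, neg_sub] at this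
      have h6 : a • (μ • z - T z) = b • z - a • T z := by
        rw [smul_sub, smul_smul, ha, mul_assoc, inv_mul_cancel₀ hμ0, mul_one]
      rw [h6, map_sub, Submodule.coe_sub] at h5
      exact sub_le_comm.1 h5
    have h7 : T w - μ ^ n • w = (T w - a ^ (-n) • T p) + a ^ (-n) • (T p - p) -
        μ ^ n • (w - b ^ (-n) • p) := by
      rw [hab]
      module
    have h8 : modulus (T w - μ ^ n • w) ≤ (ε • T p + C • (T p - reL (a • T z))) + P +
        (ε • p + C • (p - reL (b • z))) := by
      rw [h7]
      refine (modulus_sub_le _ _).trans (add_le_add ((modulus_add_le _ _).trans ?_) h3)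
      rw [h2]
      exact add_le_add_left h1 _
    have h9 : 0 ≤ (ε + C) • (p + P - T p) :=
      _root_.smul_nonneg (by positivity) (sub_nonneg.2 hTp)
    have h10 : 0 ≤ C • ((reL (a • T z) : E) - (reL (b • z) - Q)) :=
      _root_.smul_nonneg hC (sub_nonneg.2 h4)
    have h11 : 0 ≤ (1 + ε) • Q := _root_.smul_nonneg (by positivity) hQ0
    exact le_of_sub_eq
      (add_nonneg (add_nonneg (add_nonneg (sub_nonneg.2 h8) h9) h10) h11) (by module)
  have habs : ∀ {D X : E} {c : ℝ}, 0 ≤ D → 0 ≤ X → 0 ≤ c →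
      (∀ b : ℂ, ‖b‖ = 1 → D ≤ X + c • (p - reL (b • z))) → D ≤ X := by
    intro D X c hD hX hc hDX
    have hc1 : 0 < c + 1 := by positivity
    have hpb : ∀ b : ℂ, ‖b‖ = 1 → 0 ≤ p - reL (b • z) := by
      intro b hb
      have h2 := reL_smul_le b z
      rw [hb, one_smul] at h2
      exact sub_nonneg.2 h2
    have h1 : p ≤ p + (c + 1)⁻¹ • (X - D) := by
      refine modulus_le ?_ fun b hb => ?_
      · exact add_mem (hreal p hp0) (Submodule.smul_mem _ _ (sub_mem (hreal X hX) (hreal D hD)))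
      · have h2 : 0 ≤ (c + 1)⁻¹ • (X + c • (p - reL (b • z)) - D + (p - reL (b • z))) :=
          _root_.smul_nonneg (by positivity)
            (add_nonneg (sub_nonneg.2 (hDX b hb)) (hpb b hb))
        refine le_of_sub_eq h2 ?_
        match_scalars <;> field_simp
        ring
    have h3 : 0 ≤ (c + 1)⁻¹ • (X - D) := by simpa using h1
    have h4 := _root_.smul_nonneg hc1.le h3
    rw [smul_smul, mul_inv_cancel₀ hc1.ne', one_smul] at h4
    exact sub_nonneg.1 h4
  have hwp : modulus w ≤ p := by
    refine (modulus_sum_le _ _).trans (le_of_eq ?_)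
    rw [← hgs]
    refine Finset.sum_congr rfl fun i _ => ?_
    rw [hmod _ _ (hg0 i), hh, one_smul]
  refine ⟨w, hwp, ?_, ?_⟩
  · have h1 : p - modulus w ≤ ε • p := by
      refine habs (sub_nonneg.2 hwp) (_root_.smul_nonneg hε.le hp0) hC fun b hb => ?_
      refine le_trans ?_ (hwle b hb)
      rw [sub_le_iff_le_add, ← modulus_neg (w - _), neg_sub]
      have h2 : modulus (b ^ (-n) • p) = p := by
        rw [hmod _ _ hp0, norm_zpow, hb, one_zpow, one_smul]
      calc p = modulus ((b ^ (-n) • p - w) + w) := by rw [sub_add_cancel, h2]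
        _ ≤ _ := modulus_add_le _ _
    exact sub_le_iff_le_add'.1 h1
  · exact habs (modulus_nonneg _)
      (add_nonneg (_root_.smul_nonneg (by positivity) hp0)
        (_root_.smul_nonneg (by positivity) (add_nonneg hP0 hQ0)))
      (by positivity) hmain

end ComplexBanachLattice

section Spectral

variable {A : Type*} [NormedRing A] [NormedAlgebra ℂ A] [CompleteSpace A]

/-- Powers grow at most geometrically with any rate beyond the spectral radius. -/
theorem exists_norm_pow_le {a : A} (ha : spectralRadius ℂ a = 1) {s : ℝ} (hs : 1 < s) :
    ∃ B, 0 ≤ B ∧ ∀ n, ‖a ^ n‖ ≤ B * s ^ n := by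
  have h := spectrum.pow_norm_pow_one_div_tendsto_nhds_spectralRadius a
  rw [ha] at h
  have h1 : (1 : ℝ≥0∞) < ENNReal.ofReal s := by
    rw [← ENNReal.ofReal_one]
    exact (ENNReal.ofReal_lt_ofReal_iff (by linarith)).2 hs
  obtain ⟨N, hN⟩ := eventually_atTop.1 (h.eventually_lt_const h1)
  have hsn : ∀ n, 1 ≤ s ^ n := fun n => one_le_pow₀ hs.le
  refine ⟨1 + ∑ n ∈ Finset.range (N + 1), ‖a ^ n‖, by positivity, fun n => ?_⟩
  have hsum : 0 ≤ ∑ n ∈ Finset.range (N + 1), ‖a ^ n‖ := by positivity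
  rcases lt_or_ge n (N + 1) with hn | hn
  · have h2 : ‖a ^ n‖ ≤ ∑ n ∈ Finset.range (N + 1), ‖a ^ n‖ :=
      Finset.single_le_sum (f := fun n => ‖a ^ n‖) (fun i _ => norm_nonneg _)
        (Finset.mem_range.2 hn)
    nlinarith [hsn n]
  · have hn0 : n ≠ 0 := by omega
    have h2 := hN n (by omega)
    rw [ENNReal.ofReal_lt_ofReal_iff (by linarith)] at h2
    have h3 : ‖a ^ n‖ ≤ s ^ n := by
      have h4 := pow_le_pow_left₀ (by positivity) h2.le n
      rwa [one_div, Real.rpow_inv_natCast_pow (norm_nonneg _) hn0] at h4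
    nlinarith [hsn n]

/-- A resolvent at a peripheral point is a limit of polynomials in the element. -/
theorem exists_poly_approx_inverse {a : A} (ha : spectralRadius ℂ a = 1) {μ : ℂ}
    (hμ : ‖μ‖ = 1) (hμa : μ ∉ spectrum ℂ a) {ε : ℝ} (hε : 0 < ε) :
    ∃ (K : ℕ) (c : ℕ → ℂ),
      ‖1 - (∑ k ∈ Finset.range K, c k • a ^ k) * (algebraMap ℂ A μ - a)‖ ≤ ε := by
  obtain ⟨u, hu⟩ := spectrum.notMem_iff.1 hμa
  set R : A := ((u⁻¹ : Aˣ) : A)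
  set δ : ℝ := min (1 / 2) (ε / 4) with hδ
  have hδ0 : 0 < δ := by positivity
  have hδ1 : δ ≤ 1 / 2 := min_le_left _ _
  have hδε : δ ≤ ε / 4 := min_le_right _ _
  set t : ℝ := δ / (‖R‖ + 1) with ht
  have ht0 : 0 < t := by positivity
  have htR : t * ‖R‖ ≤ δ := by
    rw [ht, div_mul_eq_mul_div, div_le_iff₀ (by positivity)]
    nlinarith [norm_nonneg R]
  set ν : ℂ := ((1 + t : ℝ) : ℂ) * μ with hν
  have hνn : ‖ν‖ = 1 + t := by
    rw [hν, norm_mul, hμ, mul_one, Complex.norm_real, Real.norm_of_nonneg (by positivity)]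
  have hν0 : ν ≠ 0 := by
    rw [← norm_pos_iff, hνn]; positivity
  have hdiff : ‖ν - μ‖ = t := by
    have : ν - μ = (t : ℂ) * μ := by rw [hν]; push_cast; ring
    rw [this, norm_mul, hμ, mul_one, Complex.norm_real, Real.norm_of_nonneg ht0.le]
  obtain ⟨B, hB0, hB⟩ := exists_norm_pow_le ha (s := 1 + t / 2) (by linarith)
  have hlim : Tendsto (fun K : ℕ => B * ((1 + t / 2) / (1 + t)) ^ K) atTop (𝓝 (B * 0)) :=
    (tendsto_pow_atTop_nhds_zero_of_lt_one (by positivity)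
      ((div_lt_one (by positivity)).2 (by linarith))).const_mul B
  rw [mul_zero] at hlim
  obtain ⟨K, hK⟩ := (hlim.eventually_le_const hδ0).exists
  set P : A := (ν⁻¹ • a) ^ K with hP
  have hPn : ‖P‖ ≤ δ := by
    refine le_trans ?_ hK
    rw [hP, smul_pow, norm_smul, norm_pow, norm_inv, hνn, div_pow, inv_pow]
    calc ((1 + t) ^ K)⁻¹ * ‖a ^ K‖ ≤ ((1 + t) ^ K)⁻¹ * (B * (1 + t / 2) ^ K) := by
          gcongr; exact hB K
      _ = _ := by ring
  refine ⟨K, fun k => ν⁻¹ * ν⁻¹ ^ k, ?_⟩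
  set S : A := ∑ k ∈ Finset.range K, (ν⁻¹ * ν⁻¹ ^ k) • a ^ k with hS
  have hgeom : S * (algebraMap ℂ A ν - a) = 1 - P := by
    have h1 := geom_sum_mul_neg (ν⁻¹ • a) K
    have h2 : S = ν⁻¹ • ∑ k ∈ Finset.range K, (ν⁻¹ • a) ^ k := by
      rw [hS, Finset.smul_sum]
      exact Finset.sum_congr rfl fun k _ => by rw [smul_pow, smul_smul]
    have h3 : algebraMap ℂ A ν - a = ν • (1 - ν⁻¹ • a) := by
      rw [smul_sub, smul_smul, mul_inv_cancel₀ hν0, one_smul, Algebra.algebraMap_eq_smul_one]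
    rw [h2, h3, smul_mul_smul_comm, inv_mul_cancel₀ hν0, one_smul, h1]
  set X : A := S * (algebraMap ℂ A μ - a) with hX
  have hSX : S = X * R := by rw [hX, ← hu, mul_assoc, Units.mul_inv, mul_one]
  have hkey : 1 - X = P + (ν - μ) • (X * R) := by
    have h4 : algebraMap ℂ A ν - a = (algebraMap ℂ A μ - a) + algebraMap ℂ A (ν - μ) := by
      rw [map_sub]; abel
    rw [h4, mul_add, ← hX, ← Algebra.commutes, ← Algebra.smul_def, hSX] at hgeom
    rw [eq_sub_iff_add_eq] at hgeom
    rw [← hgeom]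
    abel
  have hXR : ‖X * R‖ ≤ (1 + ‖1 - X‖) * ‖R‖ := by
    have h5 : X * R = R - (1 - X) * R := by rw [sub_mul, one_mul]; abel
    calc ‖X * R‖ ≤ ‖R‖ + ‖1 - X‖ * ‖R‖ := by
          rw [h5]
          exact (norm_sub_le _ _).trans (by gcongr; exact norm_mul_le _ _)
      _ = _ := by ring
  have hmain : ‖1 - X‖ ≤ δ + δ * (1 + ‖1 - X‖) := by
    calc ‖1 - X‖ ≤ ‖P‖ + ‖(ν - μ) • (X * R)‖ := by
          conv_lhs => rw [hkey]
          exact norm_add_le _ _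
      _ ≤ δ + t * ((1 + ‖1 - X‖) * ‖R‖) := by
          rw [norm_smul, hdiff]; gcongr
      _ = δ + (t * ‖R‖) * (1 + ‖1 - X‖) := by ring
      _ ≤ _ := by gcongr
  nlinarith [norm_nonneg (1 - X)]

end Spectral

/-- Peripheral spectral values are approximate eigenvalues. -/
theorem exists_approx_eigenvector {E : Type*} [NormedAddCommGroup E] [NormedSpace ℂ E]
    [CompleteSpace E] {T : E →L[ℂ] E} (hr : spectralRadius ℂ T = 1) {μ : ℂ} (hμ : ‖μ‖ = 1)
    (hμT : μ ∈ spectrum ℂ T) {ε : ℝ} (hε : 0 < ε) : ∃ z : E, ‖z‖ = 1 ∧ ‖T z - μ • z‖ < ε := by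
  by_contra! hcon
  have hbelow : ∀ z : E, ε * ‖z‖ ≤ ‖T z - μ • z‖ := by
    intro z
    rcases eq_or_ne z 0 with rfl | hz
    · simp
    have hz' : (‖z‖ : ℂ) ≠ 0 := by simpa using hz
    have h := hcon ((‖z‖ : ℂ)⁻¹ • z) (by
      rw [norm_smul, norm_inv, Complex.norm_real, norm_norm, inv_mul_cancel₀ (by simpa using hz)])
    rw [map_smul, smul_comm μ, ← smul_sub, norm_smul, norm_inv, Complex.norm_real, norm_norm,
      ← div_eq_inv_mul, le_div_iff₀ (norm_pos_iff.2 hz)] at h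
    exact h
  refine hμT ?_
  set ν : ℂ := ((1 + ε / 4 : ℝ) : ℂ) * μ with hν
  have hνn : ‖ν‖ = 1 + ε / 4 := by
    rw [hν, norm_mul, hμ, mul_one, Complex.norm_real, Real.norm_of_nonneg (by positivity)]
  have hdiff : ‖ν - μ‖ = ε / 4 := by
    have : ν - μ = ((ε / 4 : ℝ) : ℂ) * μ := by rw [hν]; push_cast; ring
    rw [this, norm_mul, hμ, mul_one, Complex.norm_real, Real.norm_of_nonneg (by positivity)]
  obtain ⟨u, hu⟩ : IsUnit (algebraMap ℂ (E →L[ℂ] E) ν - T) := by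
    refine spectrum.mem_resolventSet_of_spectralRadius_lt ?_
    rw [hr, ← ENNReal.coe_one, ENNReal.coe_lt_coe, ← NNReal.coe_lt_coe, coe_nnnorm, hνn]
    simpa using hε
  set R : E →L[ℂ] E := ((u⁻¹ : (E →L[ℂ] E)ˣ) : E →L[ℂ] E) with hR
  have hR1 : (algebraMap ℂ (E →L[ℂ] E) ν - T) * R = 1 := by rw [← hu, hR, Units.mul_inv]
  have hRn : ‖R‖ ≤ 2 / ε := by
    refine ContinuousLinearMap.opNorm_le_bound _ (by positivity) fun y => ?_
    have h1 : ν • R y - T (R y) = y := by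
      simpa [Algebra.algebraMap_eq_smul_one] using congrArg (fun S : E →L[ℂ] E => S y) hR1
    have h2 : T (R y) - μ • R y = (ν - μ) • R y - y := by
      linear_combination (norm := module) (-1 : ℂ) • h1
    have h3 := hbelow (R y)
    rw [h2] at h3
    have h4 : ‖(ν - μ) • R y - y‖ ≤ ε / 4 * ‖R y‖ + ‖y‖ := by
      refine (norm_sub_le _ _).trans ?_
      rw [norm_smul, hdiff]
    rw [div_mul_eq_mul_div, le_div_iff₀ hε]
    nlinarith [norm_nonneg (R y)]
  have hsmall : ‖(ν - μ) • R‖ < 1 := by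
    rw [norm_smul, hdiff]
    calc ε / 4 * ‖R‖ ≤ ε / 4 * (2 / ε) := by gcongr
      _ = 1 / 2 := by field_simp; norm_num
      _ < 1 := by norm_num
  have hfac : algebraMap ℂ (E →L[ℂ] E) μ - T = u * (1 - (ν - μ) • R) := by
    rw [mul_sub, mul_one, mul_smul_comm, hR, Units.mul_inv, hu, ← Algebra.algebraMap_eq_smul_one,
      map_sub]
    abel
  change IsUnit (algebraMap ℂ (E →L[ℂ] E) μ - T)
  rw [hfac]
  exact u.isUnit.mul (isUnit_one_sub_of_norm_lt_one hsmall)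

namespace ComplexBanachLattice

variable {E : Type*} [NormedAddCommGroup E] [NormedSpace ℂ E] [PartialOrder E]
  [ComplexBanachLattice E]

/-- Every normalized positive element is normed by a positive functional of norm at most one. -/
theorem exists_positive_functional {x : E} (hx : 0 ≤ x) (hx1 : ‖x‖ = 1) :
    ∃ φ : E →L[ℝ] ℝ, (∀ y, 0 ≤ y → 0 ≤ φ y) ∧ (∀ y, |φ y| ≤ ‖y‖) ∧ φ x = 1 := by
  have hx0 : x ≠ 0 := by rintro rfl; simp at hx1
  have hre : ∀ y : E, 0 ≤ y → (reL y : E) = y := fun y hy => by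
    rw [reL_coe ⟨y, mem_realPart_of_nonneg hy⟩]
  have hpos : ∀ r : realPart E, (0 : E) ≤ r + modulus (r : E) := fun r => by
    have h := (modulus_isLUB (r : E) r.2).1 (Set.mem_insert_of_mem _ rfl)
    exact neg_le_iff_add_nonneg'.1 h
  set N : E → ℝ := fun z => ‖(2⁻¹ : ℝ) • ((reL z : E) + modulus (reL z : E))‖ with hN
  have hNpos : ∀ y : E, 0 ≤ y → N y = ‖y‖ := fun y hy => by
    simp only [hN, hre y hy, modulus_of_nonneg hy]
    congr 1
    module
  have hNneg : ∀ y : E, 0 ≤ y → N (-y) = 0 := fun y hy => by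
    simp only [hN, map_neg, Submodule.coe_neg, hre y hy, modulus_neg, modulus_of_nonneg hy]
    simp
  have hNle : ∀ y : E, N y ≤ ‖y‖ := fun y => by
    have h1 : ‖(reL y : E)‖ ≤ ‖y‖ := by
      refine norm_mono _ _ ?_
      rw [← coe_abs]
      exact abs_reL_le y
    calc N y ≤ 2⁻¹ * (‖(reL y : E)‖ + ‖(reL y : E)‖) := by
          simp only [hN, norm_smul]
          rw [Real.norm_of_nonneg (by norm_num)]
          gcongr
          refine (norm_add_le _ _).trans ?_
          rw [norm_modulus]
      _ ≤ ‖y‖ := by linarith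
  have hspan : ∀ (r : ℝ) (h),
      (LinearPMap.mkSpanSingleton x (1 : ℝ) hx0 : E →ₗ.[ℝ] ℝ) ⟨r • x, h⟩ = r :=
    fun r h => (LinearPMap.mkSpanSingleton'_apply _ _ _ _ h).trans (by simp)
  obtain ⟨g, hg, hgN⟩ := exists_extension_of_le_sublinear
    (LinearPMap.mkSpanSingleton x (1 : ℝ) hx0) N
    (fun r hr z => by
      simp only [hN, map_smul, Submodule.coe_smul, modulus_real_smul, abs_of_pos hr]
      rw [← smul_add, smul_comm, norm_smul, Real.norm_of_nonneg hr.le])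
    (fun z w => by
      simp only [hN, map_add, Submodule.coe_add]
      refine le_trans ?_ (norm_add_le _ _)
      rw [← smul_add]
      refine norm_le_norm_of_nonneg_of_le
        (_root_.smul_nonneg (by norm_num) (hpos (reL z + reL w))) ?_
      refine smul_le_smul_of_nonneg_left ?_ (by norm_num)
      calc _ ≤ (reL z : E) + (reL w : E) + (modulus (reL z : E) + modulus (reL w : E)) := by
            gcongr
            exact modulus_add_le _ _
        _ = _ := by abel)
    (by
      rintro ⟨y, hy⟩
      obtain ⟨r, rfl⟩ := Submodule.mem_span_singleton.1 hy
      rw [hspan]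
      rcases le_total 0 r with h | h
      · rw [hNpos _ (_root_.smul_nonneg h hx), norm_smul, hx1, mul_one]
        exact le_abs_self r
      · exact h.trans (norm_nonneg _))
  have hgle : ∀ y, |g y| ≤ ‖y‖ := fun y => by
    refine abs_le'.2 ⟨(hgN y).trans (hNle y), ?_⟩
    rw [← map_neg, ← norm_neg y]
    exact (hgN _).trans (hNle _)
  refine ⟨g.mkContinuous 1 fun y => by simpa using hgle y, fun y hy => ?_, fun y => hgle y, ?_⟩
  · have h := hgN (-y)
    rw [hNneg y hy, map_neg] at h
    simpa using h
  · have h := hspan 1 (by rw [one_smul]; exact Submodule.mem_span_singleton_self x)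
    rw [← hg] at h
    simpa using h

end ComplexBanachLattice

section Weights

variable {J : Type*} {F : Filter J} {a : J → ℕ → ℂ}

theorem coe_re_of_nonneg {z : ℂ} (hz : 0 ≤ z) : ((z.re : ℝ) : ℂ) = z :=
  (Complex.eq_re_of_ofReal_le (r := 0) (by simpa using hz)).symm

theorem re_nonneg_of_nonneg {z : ℂ} (hz : 0 ≤ z) : 0 ≤ z.re := (Complex.le_def.1 hz).1

theorem IsWeightingScheme.hasSum_re (h : IsWeightingScheme F a) (j : J) :
    HasSum (fun k => (a j k).re) 1 := by
  obtain ⟨ρ, hρ, hsum⟩ := h.1 j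
  have h1 : Summable (a j) := by simpa using hsum 1 (by simpa using hρ)
  have h2 := h1.hasSum
  rw [h.2.1 j] at h2
  simpa using Complex.hasSum_re h2

theorem IsWeightingScheme.tendsto_re (h : IsWeightingScheme F a) (k : ℕ) :
    Tendsto (fun j => (a j k).re) F (𝓝 0) := by
  have h0 := (h.2.2.2 (2⁻¹ : ℂ) (by norm_num)).norm.const_mul ((2 : ℝ) ^ k)
  rw [norm_zero, mul_zero] at h0
  refine squeeze_zero (fun j => re_nonneg_of_nonneg (h.2.2.1 j k)) (fun j => ?_) h0
  obtain ⟨ρ, hρ, hsum⟩ := h.1 j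
  have h1 := Complex.hasSum_re (hsum (2⁻¹ : ℂ) (by norm_num; linarith)).hasSum
  have h2 : ∀ i, (a j i * (2⁻¹ : ℂ) ^ i).re = (a j i).re * (2⁻¹ : ℝ) ^ i := fun i => by
    rw [← Complex.re_mul_ofReal]
    push_cast
    rfl
  simp_rw [h2] at h1
  have h3 := le_hasSum h1 k fun i _ =>
    mul_nonneg (re_nonneg_of_nonneg (h.2.2.1 j i)) (by positivity)
  have h4 := h3.trans ((le_abs_self _).trans (Complex.abs_re_le_norm _))
  calc (a j k).re = 2 ^ k * ((a j k).re * 2⁻¹ ^ k) := by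
        rw [mul_left_comm, ← mul_pow, mul_inv_cancel₀ (by norm_num), one_pow, mul_one]
    _ ≤ _ := by gcongr

/-- A weighting scheme averages null sequences to zero. -/
theorem IsWeightingScheme.tendsto_tsum_mul (h : IsWeightingScheme F a) {d : ℕ → ℝ}
    (hd : Tendsto d atTop (𝓝 0)) :
    Tendsto (fun j => ∑' k, (a j k).re * d k) F (𝓝 0) := by
  have hbdd : ∃ D, ∀ k, |d k| ≤ D := by
    obtain ⟨D, hD⟩ := hd.abs.bddAbove_range
    exact ⟨D, fun k => hD ⟨k, rfl⟩⟩
  obtain ⟨D, hD⟩ := hbdd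
  rw [Metric.tendsto_nhds]
  intro ε hε
  obtain ⟨N, hN⟩ := (Metric.tendsto_atTop.1 hd) (ε / 2) (by positivity)
  have hfin : Tendsto (fun j => ∑ k ∈ Finset.range N, (a j k).re * D) F (𝓝 0) := by
    have := tendsto_finsetSum (Finset.range N) fun k _ => (h.tendsto_re k).mul_const D
    simpa using this
  filter_upwards [hfin.eventually_lt_const (show (0 : ℝ) < ε / 2 by positivity)] with j hj
  have hs := h.hasSum_re j
  have hc := fun k => re_nonneg_of_nonneg (h.2.2.1 j k)
  have hbound : ∀ k, ‖(a j k).re * d k‖ ≤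
      (if k ∈ Finset.range N then (a j k).re * D else 0) + (a j k).re * (ε / 2) := fun k => by
    rw [Real.norm_eq_abs, abs_mul, abs_of_nonneg (hc k)]
    split_ifs with hk
    · exact (mul_le_mul_of_nonneg_left (hD k) (hc k)).trans
        (le_add_of_nonneg_right (mul_nonneg (hc k) (by positivity)))
    · rw [zero_add]
      refine mul_le_mul_of_nonneg_left ?_ (hc k)
      have := hN k (by simpa using hk)
      rw [Real.dist_eq, sub_zero] at this
      exact this.le
  have h1 : HasSum (fun k => (if k ∈ Finset.range N then (a j k).re * D else 0) +
      (a j k).re * (ε / 2)) ((∑ k ∈ Finset.range N, (a j k).re * D) + 1 * (ε / 2)) := by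
    refine HasSum.add ?_ (hs.mul_right _)
    rw [← Finset.sum_congr rfl fun k hk => if_pos hk]
    exact hasSum_sum_of_ne_finset_zero fun k hk => if_neg hk
  have h2 := tsum_of_norm_bounded h1 hbound
  rw [Real.dist_eq, sub_zero, ← Real.norm_eq_abs]
  linarith

variable {E : Type*} [NormedAddCommGroup E] [NormedSpace ℂ E] [CompleteSpace E]

theorem HasDiskRadius.summable_mul_norm_pow {b : ℕ → ℂ} (hb : HasDiskRadius b)
    {T : E →L[ℂ] E} (hr : spectralRadius ℂ T = 1) : Summable fun k => ‖b k‖ * ‖T ^ k‖ := by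
  obtain ⟨ρ, hρ, hsum⟩ := hb
  obtain ⟨B, hB0, hB⟩ := exists_norm_pow_le hr (s := (1 + ρ) / 2) (by linarith)
  have h1 := (hsum (((1 + ρ) / 2 : ℝ) : ℂ) (by
    rw [Complex.norm_real, Real.norm_of_nonneg (by linarith)]
    linarith)).norm
  refine Summable.of_nonneg_of_le (fun k => by positivity) (fun k => ?_) (h1.mul_left B)
  calc ‖b k‖ * ‖T ^ k‖ ≤ ‖b k‖ * (B * ((1 + ρ) / 2) ^ k) := by gcongr; exact hB k
    _ = B * (‖b k‖ * ((1 + ρ) / 2) ^ k) := by ring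
    _ = B * ‖b k * (((1 + ρ) / 2 : ℝ) : ℂ) ^ k‖ := by
      rw [norm_mul, norm_pow, Complex.norm_real, Real.norm_of_nonneg (by linarith)]

theorem hasSum_functional_wsApply {b : ℕ → ℂ} (hb : HasDiskRadius b) (hb0 : ∀ k, 0 ≤ b k)
    {T : E →L[ℂ] E} (hr : spectralRadius ℂ T = 1) (φ : E →L[ℝ] ℝ) (x : E) :
    HasSum (fun k => (b k).re * φ ((T ^ k) x)) (φ (wsApply b T x)) := by
  have h1 : Summable fun k => b k • T ^ k :=
    Summable.of_norm ((hb.summable_mul_norm_pow hr).congr fun k => (norm_smul _ _).symm)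
  have h2 := φ.hasSum ((ContinuousLinearMap.apply ℂ E x).hasSum h1.hasSum)
  convert h2 using 1
  · funext k
    have h3 : b k • (T ^ k) x = (b k).re • (T ^ k) x := by
      conv_lhs => rw [← coe_re_of_nonneg (hb0 k)]
      exact Complex.coe_smul _ _
    change _ = φ (b k • (T ^ k) x)
    rw [h3, map_smul, smul_eq_mul]
  · rfl

theorem tendsto_functional_wsApply {b : ℕ → ℂ} (hb : HasDiskRadius b) (hb0 : ∀ k, 0 ≤ b k)
    {T : E →L[ℂ] E} (hr : spectralRadius ℂ T = 1) {U : Filter ℕ} {φ : ℕ → E →L[ℝ] ℝ}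
    (hφ : ∀ m x, |φ m x| ≤ ‖x‖) {y : ℕ → E} {D : ℝ} (hy : ∀ m, ‖y m‖ ≤ D) {l : ℕ → ℝ}
    (hl : ∀ k, Tendsto (fun m => φ m ((T ^ k) (y m))) U (𝓝 (l k))) :
    Tendsto (fun m => φ m (wsApply b T (y m))) U (𝓝 (∑' k, (b k).re * l k)) := by
  have h1 : (fun m => φ m (wsApply b T (y m))) =
      fun m => ∑' k, (b k).re * φ m ((T ^ k) (y m)) :=
    funext fun m => (hasSum_functional_wsApply hb hb0 hr (φ m) (y m)).tsum_eq.symm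
  rw [h1]
  refine tendsto_tsum_of_dominated_convergence ((hb.summable_mul_norm_pow hr).mul_right D)
    (fun k => (hl k).const_mul _) (Eventually.of_forall fun m k => ?_)
  rw [norm_mul, mul_assoc]
  gcongr
  · exact Complex.abs_re_le_norm _
  · exact (hφ m _).trans (((T ^ k).le_opNorm _).trans (by gcongr; exact hy m))

end Weights

namespace ComplexBanachLattice

variable {E : Type*} [NormedAddCommGroup E] [NormedSpace ℂ E] [PartialOrder E]
  [ComplexBanachLattice E]

theorem isPositiveOp_pow {T : E →L[ℂ] E} (hT : IsPositiveOp T) (n : ℕ) : IsPositiveOp (T ^ n) := by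
  intro x hx
  induction n with
  | zero => simpa using hx
  | succ n ih =>
    rw [pow_succ']
    exact hT _ ih

/-- The modulus of a unimodular approximate eigenvector is almost superinvariant. -/
theorem neg_modulus_le_apply_modulus_sub {T : E →L[ℂ] E} (hT : IsPositiveOp T) {μ : ℂ}
    (hμ : ‖μ‖ = 1) (z : E) : -modulus (T z - μ • z) ≤ T (modulus z) - modulus z := by
  rw [neg_le_sub_iff_le_add]
  calc modulus z = modulus (T z - (T z - μ • z)) := by
        rw [sub_sub_cancel, modulus_smul_of_norm_eq_one hμ]
    _ ≤ modulus (T z) + modulus (T z - μ • z) := modulus_sub_le _ _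
    _ ≤ _ := by gcongr; exact modulus_apply_le hT z

theorem modulus_apply_modulus_sub_le {T : E →L[ℂ] E} (hT : IsPositiveOp T) {μ : ℂ}
    (hμ : ‖μ‖ = 1) (z : E) : modulus (T (modulus z) - modulus z) ≤
      (T (modulus z) - modulus z) + (2 : ℝ) • modulus (T z - μ • z) := by
  have he := modulus_nonneg (T z - μ • z)
  have hd := neg_modulus_le_apply_modulus_sub hT hμ z
  have hreal : T (modulus z) - modulus z ∈ realPart E :=
    Submodule.sub_mem _ (mem_realPart_of_nonneg (hT _ (modulus_nonneg z)))
      (mem_realPart_of_nonneg (modulus_nonneg z))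
  refine (modulus_isLUB _ hreal).2 ?_
  rintro y (rfl | rfl)
  · exact le_add_of_nonneg_right (_root_.smul_nonneg (by norm_num) he)
  · rw [← sub_nonneg] at hd
    refine le_of_sub_eq (_root_.smul_nonneg (by norm_num : (0 : ℝ) ≤ 2) hd) ?_
    module

/-- Banach limits along a sequence of approximate eigenvectors of a (WS)-bounded operator give
positive functionals that do not vanish on some approximate eigenvector, but are small on its
defects. -/
theorem exists_functional_of_wsBounded [CompleteSpace E] {T : E →L[ℂ] E} (hT : IsPositiveOp T)
    (hr : spectralRadius ℂ T = 1) (hws : WSBounded T) {μ : ℂ} (hμ : ‖μ‖ = 1)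
    (hμT : μ ∈ spectrum ℂ T) :
    ∃ C, 0 ≤ C ∧ ∀ ε > 0, ∀ K : ℕ, ∃ z : E, ‖z‖ = 1 ∧ ∃ ψ : E →ₗ[ℝ] ℝ,
      (∀ x, 0 ≤ x → 0 ≤ ψ x) ∧ (∀ x, ψ x ≤ C * ‖x‖) ∧ 1 / 2 ≤ ψ (modulus z) ∧
      ∀ n < K, ψ ((T ^ n) (modulus (T (modulus z) - modulus z))) ≤ ε ∧
        ψ ((T ^ n) (modulus (T z - μ • z))) ≤ ε := by
  obtain ⟨J, F, hF, a, ha, C, hC⟩ := hws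
  obtain ⟨j₀⟩ : Nonempty J := F.nonempty_of_neBot
  have hC0 : 0 ≤ C := (norm_nonneg _).trans (hC j₀)
  have hc : ∀ j k, 0 ≤ (a j k).re := fun j k => re_nonneg_of_nonneg (ha.2.2.1 j k)
  refine ⟨C, hC0, fun ε hε K => ?_⟩
  choose z hz1 hz using fun m : ℕ => exists_approx_eigenvector hr hμ hμT
    (show (0 : ℝ) < 1 / ((m : ℝ) + 1) by positivity)
  choose φ hφ0 hφ hφ1 using fun m : ℕ => exists_positive_functional (modulus_nonneg (z m))
    ((norm_modulus (z m)).trans (hz1 m))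
  set e : ℕ → E := fun m => modulus (T (z m) - μ • z m) with he
  have he0 : ∀ m, 0 ≤ e m := fun m => modulus_nonneg _
  have helim : Tendsto (fun m => ‖e m‖) atTop (𝓝 0) :=
    squeeze_zero (fun m => norm_nonneg _) (fun m => (norm_modulus _).trans_le (hz m).le)
      tendsto_one_div_add_atTop_nhds_zero_nat
  set U : Ultrafilter ℕ := hyperfilter ℕ with hU
  have hUle : (U : Filter ℕ) ≤ atTop := Nat.hyperfilter_le_atTop
  have hTn : ∀ m n x, φ m ((T ^ n) x) ≤ ‖T ^ n‖ * ‖x‖ := fun m n x =>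
    (le_abs_self _).trans ((hφ m _).trans ((T ^ n).le_opNorm x))
  -- ultrafilter limits of the orbits
  have hex : ∀ n, ∃ l, Tendsto (fun m => φ m ((T ^ n) (modulus (z m)))) U (𝓝 l) := by
    intro n
    have hmem : ∀ m, φ m ((T ^ n) (modulus (z m))) ∈ Set.Icc (-‖T ^ n‖) ‖T ^ n‖ := fun m => by
      refine abs_le.1 ((hφ m _).trans (((T ^ n).le_opNorm _).trans ?_))
      rw [norm_modulus, hz1, mul_one]
    obtain ⟨l, -, hl⟩ := isCompact_Icc.ultrafilter_le_nhds
      (U.map fun m => φ m ((T ^ n) (modulus (z m))))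
      (tendsto_principal.2 (Eventually.of_forall hmem))
    exact ⟨l, hl⟩
  choose l hl using hex
  have hl0 : l 0 = 1 := by
    refine tendsto_nhds_unique (hl 0) ?_
    simp [hφ1]
  have hdlim : ∀ k, Tendsto
      (fun m => φ m ((T ^ k) (T (modulus (z m)) - modulus (z m)))) U (𝓝 (l (k + 1) - l k)) := by
    intro k
    refine ((hl (k + 1)).sub (hl k)).congr fun m => ?_
    rw [map_sub, map_sub, pow_succ]
    rfl
  have hmono : Monotone l := by
    refine monotone_nat_of_le_succ fun n => ?_
    rw [← sub_nonneg]
    have h1 : Tendsto (fun m => -(‖T ^ n‖ * ‖e m‖)) U (𝓝 0) := by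
      simpa using ((helim.const_mul ‖T ^ n‖).neg).mono_left hUle
    refine le_of_tendsto_of_tendsto' h1 (hdlim n) fun m => ?_
    have h2 := hφ0 m _ (isPositiveOp_pow hT n _ (sub_nonneg.2
      (neg_modulus_le_apply_modulus_sub hT hμ (z m))))
    rw [sub_neg_eq_add, map_add, map_add] at h2
    have h3 := hTn m n (e m)
    linarith
  have hweak := fun j (y : ℕ → E) D (hy : ∀ m, ‖y m‖ ≤ D) b hb =>
    tendsto_functional_wsApply (ha.1 j) (ha.2.2.1 j) hr (U := U) hφ (y := y) hy (l := b) hb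
  have hwl := fun j => hweak j (fun m => modulus (z m)) 1
    (fun m => ((norm_modulus _).trans (hz1 m)).le) l hl
  have hψle : ∀ j m x, φ m (wsApply (a j) T x) ≤ C * ‖x‖ := fun j m x =>
    (le_abs_self _).trans ((hφ m _).trans (((wsApply (a j) T).le_opNorm x).trans
      (by gcongr; exact hC j)))
  have hl_nonneg : ∀ k, 1 ≤ l k := fun k => hl0.symm.le.trans (hmono (Nat.zero_le k))
  have hTnorm : ∀ k, l k ≤ ‖T ^ k‖ := fun k => by
    refine le_of_tendsto' (hl k) fun m => (hTn m k _).trans ?_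
    rw [norm_modulus, hz1, mul_one]
  have hsummable : ∀ j, Summable fun k => (a j k).re * l k := fun j =>
    Summable.of_nonneg_of_le (fun k => mul_nonneg (hc j k) (zero_le_one.trans (hl_nonneg k)))
      (fun k => mul_le_mul (Complex.re_le_norm _) (hTnorm k) (zero_le_one.trans (hl_nonneg k))
        (norm_nonneg _)) ((ha.1 j).summable_mul_norm_pow hr)
  have havg_le : ∀ j, ∑' k, (a j k).re * l k ≤ C := fun j => by
    refine le_of_tendsto' (hwl j) fun m => (hψle j m _).trans ?_
    rw [norm_modulus, hz1, mul_one]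
  have havg_ge : ∀ j, 1 ≤ ∑' k, (a j k).re * l k := fun j => by
    refine hasSum_le (fun k => ?_) (ha.hasSum_re j) (hsummable j).hasSum
    exact le_mul_of_one_le_right (hc j k) (hl_nonneg k)
  have hlC : ∀ n, l n ≤ C := fun n => by
    have h1 : ∀ j, l n * (1 - ∑ k ∈ Finset.range n, (a j k).re) ≤ C := fun j => by
      have h2 := (hasSum_nat_add_iff' n).2 (ha.hasSum_re j)
      refine (hasSum_le (fun k => ?_) (h2.mul_left (l n))
        ((summable_nat_add_iff n).2 (hsummable j)).hasSum).trans (le_trans ?_ (havg_le j))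
      · rw [mul_comm]
        exact mul_le_mul_of_nonneg_left (hmono (Nat.le_add_left n k)) (hc j _)
      · rw [← (hsummable j).sum_add_tsum_nat_add n]
        exact le_add_of_nonneg_left (Finset.sum_nonneg fun k _ =>
          mul_nonneg (hc j k) (zero_le_one.trans (hl_nonneg k)))
    have h3 : Tendsto (fun j => l n * (1 - ∑ k ∈ Finset.range n, (a j k).re)) F (𝓝 (l n)) := by
      have := ((tendsto_finsetSum (Finset.range n) fun k _ =>
        ha.tendsto_re k).const_sub 1).const_mul (l n)
      simpa using this
    exact le_of_tendsto' h3 h1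
  obtain ⟨L, hL⟩ : ∃ L, Tendsto l atTop (𝓝 L) :=
    ⟨_, tendsto_atTop_ciSup hmono ⟨C, by rintro _ ⟨n, rfl⟩; exact hlC n⟩⟩
  have hdiff : Tendsto (fun k => l (k + 1) - l k) atTop (𝓝 0) := by
    simpa using ((tendsto_add_atTop_iff_nat 1).2 hL).sub hL
  obtain ⟨j, hj⟩ : ∃ j, ∀ n ∈ Finset.range K,
      ∑' k, (a j k).re * (l (k + n + 1) - l (k + n)) < ε / 2 := by
    refine Eventually.exists (f := F) ?_
    rw [Finset.eventually_all]
    intro n _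
    exact (ha.tendsto_tsum_mul ((tendsto_add_atTop_iff_nat n).2 hdiff)).eventually_lt_const
      (by positivity)
  have hψ0 : ∀ m x, 0 ≤ x → 0 ≤ φ m (wsApply (a j) T x) := fun m x hx =>
    (hasSum_functional_wsApply (ha.1 j) (ha.2.2.1 j) hr (φ m) x).nonneg fun k =>
      mul_nonneg (hc j k) (hφ0 m _ (isPositiveOp_pow hT k _ hx))
  have hev : ∀ᶠ m in U, 1 / 2 ≤ φ m (wsApply (a j) T (modulus (z m))) ∧
      ∀ n ∈ Finset.range K,
        φ m (wsApply (a j) T ((T ^ n) (T (modulus (z m)) - modulus (z m)))) < ε / 2 ∧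
        C * (‖T ^ n‖ * ‖e m‖) < ε / 4 := by
    refine ((hwl j).eventually_const_le (by linarith [havg_ge j])).and ?_
    rw [Finset.eventually_all]
    intro n hn
    refine Eventually.and ?_ ?_
    · refine (hweak j (fun m => (T ^ n) (T (modulus (z m)) - modulus (z m)))
        (‖T ^ n‖ * (‖T‖ + 1)) (fun m => ?_) (fun k => l (k + n + 1) - l (k + n))
        fun k => ?_).eventually_lt_const (hj n hn)
      · refine ((T ^ n).le_opNorm _).trans ?_
        gcongr
        refine (norm_sub_le _ _).trans ?_
        have := T.le_opNorm (modulus (z m))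
        rw [norm_modulus, hz1, mul_one] at this
        rw [norm_modulus, hz1]
        gcongr
      · simp_rw [← mul_apply_eq_comp, ← pow_add]
        exact hdlim (k + n)
    · have h1 := ((helim.const_mul ‖T ^ n‖).const_mul C).mono_left hUle
      rw [mul_zero, mul_zero] at h1
      exact h1.eventually_lt_const (by positivity)
  obtain ⟨m, hm1, hm⟩ := hev.exists
  refine ⟨z m, hz1 m, (φ m : E →ₗ[ℝ] ℝ).comp
    ((wsApply (a j) T : E →ₗ[ℂ] E).restrictScalars ℝ), hψ0 m, hψle j m, hm1, fun n hn => ?_⟩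
  obtain ⟨hd, hem⟩ := hm n (Finset.mem_range.2 hn)
  change φ m (wsApply (a j) T ((T ^ n) (modulus (T (modulus (z m)) - modulus (z m))))) ≤ ε ∧
    φ m (wsApply (a j) T ((T ^ n) (e m))) ≤ ε
  have h1 : φ m (wsApply (a j) T ((T ^ n) (e m))) ≤ ε / 4 :=
    (hψle j m _).trans ((mul_le_mul_of_nonneg_left ((T ^ n).le_opNorm _) hC0).trans hem.le)
  refine ⟨?_, by linarith⟩
  have h2 := hψ0 m _ (isPositiveOp_pow hT n _ (sub_nonneg.2
    (modulus_apply_modulus_sub_le hT hμ (z m))))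
  have h3 : (2 : ℝ) • modulus (T (z m) - μ • z m) = e m + e m := two_smul ℝ _
  rw [h3] at h2
  simp only [map_sub, map_add] at h2 hd ⊢
  linarith

end ComplexBanachLattice

namespace ComplexBanachLattice

/-- The peripheral spectrum of a (WS)-bounded positive operator is stable under integer powers. -/
theorem zpow_mem_spectrum {E : Type*} [NormedAddCommGroup E] [NormedSpace ℂ E] [CompleteSpace E]
    [PartialOrder E] [ComplexBanachLattice E] {T : E →L[ℂ] E} (hT : IsPositiveOp T)
    (hr : spectralRadius ℂ T = 1) (hws : WSBounded T) {μ : ℂ} (hμ : ‖μ‖ = 1)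
    (hμT : μ ∈ spectrum ℂ T) (n : ℤ) : μ ^ n ∈ spectrum ℂ T := by
  by_contra hn
  obtain ⟨C, hC0, hC⟩ := exists_functional_of_wsBounded hT hr hws hμ hμT
  obtain ⟨K, c, hKc⟩ := exists_poly_approx_inverse hr (by rw [norm_zpow, hμ, one_zpow]) hn
    (ε := 1 / (16 * (C + 1))) (by positivity)
  set S : E →L[ℂ] E := ∑ k ∈ Finset.range K, c k • T ^ k with hS
  set M₁ : ℝ := ∑ k ∈ Finset.range K, ‖c k‖ * (C * ‖T ^ k‖) with hM₁
  set M₂ : ℝ := ∑ k ∈ Finset.range K, ‖c k‖ with hM₂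
  have hM₁0 : 0 ≤ M₁ := by positivity
  have hM₂0 : 0 ≤ M₂ := by positivity
  set δ : ℝ := 1 / (32 * (M₁ + 1)) with hδ
  have hδ0 : 0 < δ := by positivity
  clear_value δ
  obtain ⟨D, hD0, hD⟩ := exists_approx_eigenvector_zpow hT hμ n hδ0
  set η : ℝ := 1 / (32 * (D * M₂ + 1)) with hη
  have hη0 : 0 < η := by positivity
  clear_value η
  obtain ⟨z, hz, ψ, hψ0, hψC, hψz, hψ⟩ := hC η hη0 K
  obtain ⟨w, hwz, hzw, hw⟩ := hD z
  have hψmono : ∀ x y : E, x ≤ y → ψ x ≤ ψ y := fun x y h => by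
    have := hψ0 _ (sub_nonneg.2 h)
    rw [map_sub] at this
    linarith
  have hψw : (1 - δ) / 2 ≤ ψ (modulus w) := by
    have h := hψmono _ _ hzw
    have hδ1 : δ ≤ 1 := by
      rw [hδ, div_le_one (by positivity)]; linarith
    rw [map_add, map_smul, smul_eq_mul] at h
    nlinarith
  have hwn : ‖w‖ ≤ 1 := by
    rw [← hz]; exact norm_mono _ _ hwz
  set u : E := T w - μ ^ n • w with hu
  have hdefect : ∀ k ∈ Finset.range K,
      ψ ((T ^ k) (modulus u)) ≤ 2 * δ * (C * ‖T ^ k‖) + 2 * D * η := fun k hk => by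
    have h := hψmono _ _ (apply_le_apply (isPositiveOp_pow hT k) hw)
    have hreal : ∀ (r : ℝ) (x : E), (T ^ k) (r • x) = r • (T ^ k) x := fun r x => by
      rw [smul_eq_coe_smul, map_smul, smul_eq_coe_smul]
    simp only [map_add, hreal, map_smul, smul_eq_mul] at h
    obtain ⟨h1, h2⟩ := hψ k (Finset.mem_range.1 hk)
    have h3 : ψ ((T ^ k) (modulus z)) ≤ C * ‖T ^ k‖ := by
      refine (hψC _).trans (mul_le_mul_of_nonneg_left (((T ^ k).le_opNorm _).trans ?_) hC0)
      rw [norm_modulus, hz, mul_one]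
    calc ψ ((T ^ k) (modulus u)) ≤ 2 * δ * (C * ‖T ^ k‖) + D * (η + η) := by
          exact h.trans (add_le_add (mul_le_mul_of_nonneg_left h3 (by positivity))
            (mul_le_mul_of_nonneg_left (add_le_add h1 h2) hD0))
      _ = _ := by ring
  have hmod : modulus w ≤
      modulus ((1 - S * (algebraMap ℂ (E →L[ℂ] E) (μ ^ n) - T)) w) +
        ∑ k ∈ Finset.range K, ‖c k‖ • (T ^ k) (modulus u) := by
    have h1 : w = (1 - S * (algebraMap ℂ (E →L[ℂ] E) (μ ^ n) - T)) w - S u := by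
      have h2 : (algebraMap ℂ (E →L[ℂ] E) (μ ^ n) - T) w = -u := by
        simp [Algebra.algebraMap_eq_smul_one, hu]
      change w = w - S ((algebraMap ℂ (E →L[ℂ] E) (μ ^ n) - T) w) - S u
      rw [h2, map_neg]
      abel
    have h3 : modulus (S u) ≤ ∑ k ∈ Finset.range K, ‖c k‖ • (T ^ k) (modulus u) := by
      rw [hS, sum_apply]
      refine (modulus_sum_le _ _).trans (Finset.sum_le_sum fun k _ => ?_)
      rw [smul_apply, modulus_smul, ← smul_eq_coe_smul]
      exact smul_le_smul_of_nonneg_left (modulus_apply_le (isPositiveOp_pow hT k) u)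
        (norm_nonneg _)
    conv_lhs => rw [h1]
    exact (modulus_sub_le _ _).trans (by gcongr)
  have hupper : ψ (modulus w) ≤ C * (1 / (16 * (C + 1))) + (2 * δ * M₁ + 2 * D * η * M₂) := by
    refine (hψmono _ _ hmod).trans ?_
    rw [map_add, map_sum]
    refine add_le_add ((hψC _).trans ?_) ?_
    · rw [norm_modulus]
      refine mul_le_mul_of_nonneg_left ((ContinuousLinearMap.le_opNorm _ w).trans ?_) hC0
      calc _ ≤ 1 / (16 * (C + 1)) * 1 := by gcongr
        _ = _ := mul_one _
    · rw [hM₁, hM₂, Finset.mul_sum, Finset.mul_sum, ← Finset.sum_add_distrib]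
      refine Finset.sum_le_sum fun k hk => ?_
      rw [map_smul, smul_eq_mul]
      calc ‖c k‖ * ψ ((T ^ k) (modulus u))
          ≤ ‖c k‖ * (2 * δ * (C * ‖T ^ k‖) + 2 * D * η) := by gcongr; exact hdefect k hk
        _ = _ := by ring
  have hA : C * (1 / (16 * (C + 1))) ≤ 1 / 16 := by
    rw [mul_one_div, div_le_div_iff₀ (by positivity) (by norm_num)]
    linarith
  have hB : 2 * δ * M₁ ≤ 1 / 16 := by
    rw [hδ, mul_one_div, div_mul_eq_mul_div, div_le_div_iff₀ (by positivity) (by norm_num)]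
    linarith
  have hE : 2 * D * η * M₂ ≤ 1 / 16 := by
    rw [hη, mul_one_div, div_mul_eq_mul_div, div_le_div_iff₀ (by positivity) (by norm_num)]
    linarith
  have hδ32 : δ ≤ 1 / 32 := by
    rw [hδ]
    gcongr
    linarith
  linarith

end ComplexBanachLattice

/-- **Theorem 7.1.** Let `T` be a positive operator on a complex Banach lattice `E` with
`r(T) = 1`. If `T` is (WS)-bounded, then the peripheral spectrum of `T` is cyclic:
`e^{iθ} ∈ σ(T)` implies `e^{inθ} ∈ σ(T)` for every `n ∈ ℤ`. -/
theorem ws_bounded_peripheral_spectrum_cyclic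
    {E : Type*} [NormedAddCommGroup E] [NormedSpace ℂ E] [CompleteSpace E] [PartialOrder E]
    [ComplexBanachLattice E]
    (T : E →L[ℂ] E) (hT : IsPositiveOp T)
    (hr : spectralRadius ℂ T = 1)
    (hws : WSBounded T) :
    ∀ θ : ℝ, Complex.exp (θ * Complex.I) ∈ spectrum ℂ T →
      ∀ n : ℤ, Complex.exp ((n : ℂ) * θ * Complex.I) ∈ spectrum ℂ T := by
  intro θ hθ n
  rw [mul_assoc, Complex.exp_int_mul]
  exact ComplexBanachLattice.zpow_mem_spectrum hT hr hws (Complex.norm_exp_ofReal_mul_I θ) hθ n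

end
end
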